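/- arXiv:1310.5595 — 5 statements merged into one kernel-verified Lean document; each statement's English description precedes it below -/
import Mathlib

section
/- Let X be an irreducible p-tuple of complex matrices over an index set Λ. Then for each integer n ≥ 1, stab(n ⊙ X) = { I_p ⊗ U : U ∈ U_n }, where for U = [z_{jk}] ∈ U_n the matrix I_p ⊗ U is the (np)×(np) block matrix whose (j,k) block is z_{jk} I_p. -/
noncomputable section

/-- A tuple of complex matrices over an index set `Λ`: a family of `n × n` complex
matrices indexed by `Λ`, where `n ≥ 1` is the *degree* of the tuple. -/
structure MatTup (Λ : Type*) where
  deg : ℕ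
  deg_pos : 0 < deg
  mat : Λ → Matrix (Fin deg) (Fin deg) ℂ

namespace MatTup

variable {Λ : Type*}

/-- The unitary action `U.X = (U Xₗ U⁻¹)ₗ`. -/
def act (X : MatTup Λ) (U : Matrix (Fin X.deg) (Fin X.deg) ℂ) : MatTup Λ :=
  ⟨X.deg, X.deg_pos, fun l => U * X.mat l * U⁻¹⟩

/-- Direct sum `X ⊕ Y`, the tuple of block-diagonal matrices. -/
def dsum (X Y : MatTup Λ) : MatTup Λ :=
  ⟨X.deg + Y.deg, Nat.add_pos_left X.deg_pos _, fun l =>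
    Matrix.reindex finSumFinEquiv finSumFinEquiv (Matrix.fromBlocks (X.mat l) 0 0 (Y.mat l))⟩

/-- Unitary equivalence `X ≡ Y`: the degrees agree and some unitary `U` satisfies `U.X = Y`. -/
def UEquiv (X Y : MatTup Λ) : Prop :=
  ∃ U ∈ Matrix.unitaryGroup (Fin X.deg) ℂ, X.act U = Y

/-- `X ≼ Y`: either `X ≡ Y`, or there are `A`, `B` with `X ≡ A` and `Y ≡ A ⊕ B`. -/
def Sub (X Y : MatTup Λ) : Prop :=
  X.UEquiv Y ∨ ∃ A B : MatTup Λ, X.UEquiv A ∧ Y.UEquiv (A.dsum B)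

/-- Disjointness `X ⊥ Y`: no tuple `A` satisfies both `A ≼ X` and `A ≼ Y`. -/
def Disj (X Y : MatTup Λ) : Prop :=
  ¬∃ A : MatTup Λ, A.Sub X ∧ A.Sub Y

/-- `X` is irreducible if no unitary `V` satisfies `V.X = A ⊕ B` for tuples `A`, `B`. -/
def Irred (X : MatTup Λ) : Prop :=
  ¬∃ (A B : MatTup Λ) (V : Matrix (Fin X.deg) (Fin X.deg) ℂ),
      V ∈ Matrix.unitaryGroup (Fin X.deg) ℂ ∧ X.act V = A.dsum B

/-- The stabilizer of `X`: all unitaries `U` with `U.X = X`. -/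
def stab (X : MatTup Λ) : Set (Matrix (Fin X.deg) (Fin X.deg) ℂ) :=
  {U | U ∈ Matrix.unitaryGroup (Fin X.deg) ℂ ∧ X.act U = X}

/-- The direct sum `T 0 ⊕ T 1 ⊕ ⋯` of a nonempty finite family of tuples
(associated to the left). -/
def bigDsum : {k : ℕ} → (Fin k → MatTup Λ) → 0 < k → MatTup Λ
  | 0, _, h => absurd h (lt_irrefl 0)
  | 1, T, _ => T 0
  | k + 2, T, _ =>
      (bigDsum (fun j : Fin (k + 1) => T j.castSucc) k.succ_pos).dsum (T (Fin.last (k + 1)))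

end MatTup

/-- The `n`-fold direct sum `n ⊙ X = X ⊕ ⋯ ⊕ X`. -/
def MatTup.nsum {Λ : Type*} (X : MatTup Λ) (n : ℕ) (hn : 0 < n) : MatTup Λ :=
  ⟨X.deg * n, Nat.mul_pos X.deg_pos hn, fun l =>
    Matrix.reindex finProdFinEquiv finProdFinEquiv
      (Matrix.blockDiagonal fun _ : Fin n => X.mat l)⟩

open Matrix in
theorem aux_split {Λ : Type*} (p : ℕ) (hp : 0 < p) (M : Λ → Matrix (Fin p) (Fin p) ℂ)
    (V : Matrix (Fin p) (Fin p) ℂ) (hV : V ∈ Matrix.unitaryGroup (Fin p) ℂ)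
    (P : Fin p → Prop) (i0 i1 : Fin p) (h0 : P i0) (h1 : ¬ P i1)
    (h : ∀ l i j, (P i ↔ ¬ P j) → (V * M l * star V) i j = 0) :
    ¬ (MatTup.mk p hp M).Irred := by
  classical
  intro hI
  obtain ⟨a, ha⟩ : ∃ a, a = Fintype.card {i // P i} := ⟨_, rfl⟩
  obtain ⟨b, hb⟩ : ∃ b, b = Fintype.card {i // ¬ P i} := ⟨_, rfl⟩
  have ha0 : 0 < a := by
    rw [ha]; exact Fintype.card_pos_iff.mpr ⟨⟨i0, h0⟩⟩
  have hb0 : 0 < b := by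
    rw [hb]; exact Fintype.card_pos_iff.mpr ⟨⟨i1, h1⟩⟩
  have hab : p = a + b := by
    have := Fintype.card_congr (Equiv.sumCompl P)
    rw [Fintype.card_sum, Fintype.card_fin, ← ha, ← hb] at this
    exact this.symm
  let ea : Fin a ≃ {i // P i} := (Fintype.equivFinOfCardEq ha.symm).symm
  let eb : Fin b ≃ {i // ¬ P i} := (Fintype.equivFinOfCardEq hb.symm).symm
  let e : Fin a ⊕ Fin b ≃ Fin p := (Equiv.sumCongr ea eb).trans (Equiv.sumCompl P)
  have el : ∀ x, P (e (Sum.inl x)) := fun x => by simpa [e] using (ea x).2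
  have er : ∀ x, ¬ P (e (Sum.inr x)) := fun x => by simpa [e] using (eb x).2
  clear_value e
  clear ea eb ha hb
  subst hab
  let s : Fin (a + b) ≃ Fin (a + b) := finSumFinEquiv.symm.trans e
  have hVV : (V.submatrix s id) * (star V).submatrix id s = 1 := by
    have h3 : (V.submatrix s id) * (star V).submatrix id s = (V * star V).submatrix s s := by
      ext i j; simp [Matrix.mul_apply]
    rw [h3, Matrix.mem_unitaryGroup_iff.mp hV]
    simp
  refine hI ⟨⟨a, ha0, fun l => (V * M l * star V).submatrix (e ∘ Sum.inl) (e ∘ Sum.inl)⟩,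
    ⟨b, hb0, fun l => (V * M l * star V).submatrix (e ∘ Sum.inr) (e ∘ Sum.inr)⟩,
    V.submatrix s id, ?_, ?_⟩
  · rw [Matrix.mem_unitaryGroup_iff]
    exact hVV
  · have key : ∀ l, V.submatrix s id * M l * (V.submatrix s id)⁻¹ =
        Matrix.reindex finSumFinEquiv finSumFinEquiv (Matrix.fromBlocks
          ((V * M l * star V).submatrix (e ∘ Sum.inl) (e ∘ Sum.inl)) 0 0
          ((V * M l * star V).submatrix (e ∘ Sum.inr) (e ∘ Sum.inr))) := by
      intro l
      rw [Matrix.inv_eq_right_inv hVV]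
      have : V.submatrix s id * M l * (star V).submatrix id s
          = (V * M l * star V).submatrix s s := by
        ext i j; simp [Matrix.mul_apply]
      rw [this]
      have h2 : Matrix.fromBlocks
          ((V * M l * star V).submatrix (e ∘ Sum.inl) (e ∘ Sum.inl)) 0 0
          ((V * M l * star V).submatrix (e ∘ Sum.inr) (e ∘ Sum.inr))
          = (V * M l * star V).submatrix e e := by
        ext i j
        rcases i with i | i <;> rcases j with j | j
        · simp
        · have := h l (e (Sum.inl i)) (e (Sum.inr j)) (by simp [el, er])
          simp only [Matrix.submatrix_apply, this]; simp
        · have := h l (e (Sum.inr i)) (e (Sum.inl j)) (by simp [el, er])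
          simp only [Matrix.submatrix_apply, this]; simp
        · simp
      rw [h2]
      rfl
    unfold MatTup.act MatTup.dsum
    simp only [MatTup.mk.injEq, heq_eq_eq, true_and]
    funext l
    exact key l

open Matrix in
theorem aux_herm {Λ : Type*} (X : MatTup Λ) (hX : X.Irred)
    (H : Matrix (Fin X.deg) (Fin X.deg) ℂ) (hH : H.IsHermitian)
    (hc : ∀ l, H * X.mat l = X.mat l * H) : ∃ c : ℂ, H = c • 1 := by
  obtain ⟨p, hp, M⟩ := X
  dsimp only at H hH hc ⊢
  let U : Matrix (Fin p) (Fin p) ℂ := hH.eigenvectorUnitary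
  have hU : star U * U = 1 := Matrix.mem_unitaryGroup_iff'.mp hH.eigenvectorUnitary.2
  have hU' : U * star U = 1 := Matrix.mem_unitaryGroup_iff.mp hH.eigenvectorUnitary.2
  obtain ⟨d, hd⟩ : ∃ d : Fin p → ℂ, H = U * Matrix.diagonal d * star U :=
    ⟨_, by
      have := hH.spectral_theorem
      rw [Unitary.conjStarAlgAut_apply] at this
      exact this⟩
  have hD : star U * H = Matrix.diagonal d * star U := by
    rw [hd, ← mul_assoc, ← mul_assoc, hU, one_mul]
  have hD' : H * U = U * Matrix.diagonal d := by
    rw [hd, mul_assoc, hU, mul_one]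
  by_cases hs : ∀ i, d i = d ⟨0, hp⟩
  · refine ⟨d ⟨0, hp⟩, ?_⟩
    have : Matrix.diagonal d = d ⟨0, hp⟩ • (1 : Matrix (Fin p) (Fin p) ℂ) := by
      rw [Matrix.smul_one_eq_diagonal]
      congr 1; funext i; exact hs i
    rw [hd, this]
    simp [hU']
  · push Not at hs
    obtain ⟨i1, hi1⟩ := hs
    exfalso
    refine aux_split p hp M (star U) ?_ (fun i => d i = d ⟨0, hp⟩) ⟨0, hp⟩ i1 rfl hi1 ?_ hX
    · rw [Matrix.mem_unitaryGroup_iff, star_star]; exact hU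
    · intro l i j hij
      rw [star_star]
      have hcomm : Matrix.diagonal d * (star U * M l * U) = (star U * M l * U) * Matrix.diagonal d := by
        calc _ = (Matrix.diagonal d * star U) * M l * U := by simp only [mul_assoc]
          _ = star U * (H * M l) * U := by rw [← hD]; simp only [mul_assoc]
          _ = star U * M l * (H * U) := by rw [hc l]; simp only [mul_assoc]
          _ = _ := by rw [hD']; simp only [mul_assoc]
      have h2 := congrFun (congrFun hcomm i) j
      rw [Matrix.diagonal_mul, Matrix.mul_diagonal] at h2
      have hne : d i ≠ d j := by
        intro he
        simp only [he] at hij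
        tauto
      have h3 : (d i - d j) * (star U * M l * U) i j = 0 := by
        rw [sub_mul, h2]; ring
      exact (mul_eq_zero.mp h3).resolve_left (sub_ne_zero.mpr hne)

open Matrix in
theorem aux_scalar {Λ : Type*} (X : MatTup Λ) (hX : X.Irred)
    (H : Matrix (Fin X.deg) (Fin X.deg) ℂ)
    (hc : ∀ l, H * X.mat l = X.mat l * H) (hc' : ∀ l, Hᴴ * X.mat l = X.mat l * Hᴴ) :
    ∃ c : ℂ, H = c • 1 := by
  obtain ⟨c1, h1⟩ := aux_herm X hX (H + Hᴴ) (Matrix.isHermitian_add_transpose_self H)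
    (fun l => by rw [add_mul, mul_add, hc, hc'])
  obtain ⟨c2, h2⟩ := aux_herm X hX (Complex.I • (H - Hᴴ)) (by
      unfold Matrix.IsHermitian
      rw [Matrix.conjTranspose_smul, Matrix.conjTranspose_sub, Matrix.conjTranspose_conjTranspose]
      simp only [Complex.star_def, Complex.conj_I, smul_sub, neg_smul]
      abel)
    (fun l => by rw [smul_mul_assoc, mul_smul_comm, sub_mul, mul_sub, hc, hc'])
  refine ⟨(c1 - Complex.I * c2) / 2, ?_⟩
  have h3 : H = (1 / 2 : ℂ) • ((H + Hᴴ) - Complex.I • (Complex.I • (H - Hᴴ))) := by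
    ext i j
    simp only [Matrix.smul_apply, Matrix.sub_apply, Matrix.add_apply, smul_eq_mul]
    linear_combination (-(1/2) * (H i j - Hᴴ i j)) * -Complex.I_mul_I
  rw [h3, h1, h2]
  ext i j
  simp only [Matrix.smul_apply, Matrix.sub_apply, smul_eq_mul]
  ring

open Matrix in
theorem aux_block {p n : ℕ} (W : Matrix (Fin p × Fin n) (Fin p × Fin n) ℂ)
    (M : Matrix (Fin p) (Fin p) ℂ)
    (h : W * Matrix.blockDiagonal (fun _ : Fin n => M) =
      Matrix.blockDiagonal (fun _ : Fin n => M) * W) (a b : Fin n) :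
    (Matrix.of fun i j => W (i, a) (j, b)) * M = M * (Matrix.of fun i j => W (i, a) (j, b)) := by
  ext i j
  have := congrFun (congrFun h (i, a)) (j, b)
  simpa [Matrix.mul_apply, Fintype.sum_prod_type, Matrix.blockDiagonal_apply, ite_and] using this

open Matrix in
/-- For an irreducible `p`-tuple `X` and `n ≥ 1`, in product coordinates. -/
theorem aux_main {Λ : Type*} (X : MatTup Λ) (hX : X.Irred) (n : ℕ)
    (W : Matrix (Fin X.deg × Fin n) (Fin X.deg × Fin n) ℂ)
    (hW : W * star W = 1)
    (h : ∀ l, W * Matrix.blockDiagonal (fun _ : Fin n => X.mat l) =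
      Matrix.blockDiagonal (fun _ : Fin n => X.mat l) * W) :
    ∃ U ∈ Matrix.unitaryGroup (Fin n) ℂ,
      W = Matrix.kroneckerMap (· * ·) (1 : Matrix (Fin X.deg) (Fin X.deg) ℂ) U := by
  have hW' : star W * W = 1 := mul_eq_one_comm.mp hW
  have h' : ∀ l, star W * Matrix.blockDiagonal (fun _ : Fin n => X.mat l) =
      Matrix.blockDiagonal (fun _ : Fin n => X.mat l) * star W := by
    intro l
    set B := Matrix.blockDiagonal (fun _ : Fin n => X.mat l)
    calc star W * B = star W * (B * W) * star W := by rw [mul_assoc, mul_assoc, hW, mul_one]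
      _ = star W * W * B * star W := by
        rw [← show W * B = B * W from h l]; simp only [mul_assoc]
      _ = _ := by rw [hW', one_mul]
  have hex : ∀ a b : Fin n, ∃ c : ℂ,
      (Matrix.of fun i j => W (i, a) (j, b) : Matrix (Fin X.deg) (Fin X.deg) ℂ) = c • 1 := by
    intro a b
    refine aux_scalar X hX _ (fun l => aux_block W _ (h l) a b) (fun l => ?_)
    exact aux_block (star W) _ (h' l) b a
  choose u hu using hex
  have hWu : W = Matrix.kroneckerMap (· * ·) (1 : Matrix (Fin X.deg) (Fin X.deg) ℂ)
      (Matrix.of u) := by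
    ext ⟨i, a⟩ ⟨j, b⟩
    have := congrFun (congrFun (hu a b) i) j
    simp only [Matrix.of_apply, Matrix.smul_apply, smul_eq_mul] at this
    simp only [Matrix.kroneckerMap_apply, Matrix.of_apply, this]
    ring
  refine ⟨Matrix.of u, ?_, hWu⟩
  rw [Matrix.mem_unitaryGroup_iff]
  ext a b
  have := congrFun (congrFun hW (⟨0, X.deg_pos⟩, a)) (⟨0, X.deg_pos⟩, b)
  rw [hWu] at this
  simpa [Matrix.mul_apply, Fintype.sum_prod_type, Matrix.one_apply, Matrix.star_apply] using this

/-- For an irreducible `p`-tuple `X` and `n ≥ 1`,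
`stab(n ⊙ X) = { I_p ⊗ U : U ∈ U_n }`. -/
theorem stmt_3 {Λ : Type*} [Nonempty Λ] (X : MatTup Λ) (hX : X.Irred) (n : ℕ) (hn : 0 < n) :
    (X.nsum n hn).stab =
      {W | ∃ U ∈ Matrix.unitaryGroup (Fin n) ℂ,
        W = Matrix.reindex finProdFinEquiv finProdFinEquiv
          (Matrix.kroneckerMap (· * ·) (1 : Matrix (Fin X.deg) (Fin X.deg) ℂ) U)} := by
  have hstab : ∀ W : Matrix (Fin (X.deg * n)) (Fin (X.deg * n)) ℂ,
      W ∈ (X.nsum n hn).stab ↔ W * star W = 1 ∧ ∀ l, W * Matrix.reindex finProdFinEquiv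
        finProdFinEquiv (Matrix.blockDiagonal fun _ : Fin n => X.mat l) =
        Matrix.reindex finProdFinEquiv
        finProdFinEquiv (Matrix.blockDiagonal fun _ : Fin n => X.mat l) * W := by
    intro W
    have e1 : W ∈ (X.nsum n hn).stab ↔ W ∈ Matrix.unitaryGroup (Fin (X.deg * n)) ℂ ∧
        (X.nsum n hn).act W = X.nsum n hn := Iff.rfl
    rw [e1, Matrix.mem_unitaryGroup_iff]
    refine and_congr_right fun hW => ?_
    have hinv : W⁻¹ = star W := Matrix.inv_eq_right_inv hW
    have hW' : star W * W = 1 := mul_eq_one_comm.mp hW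
    unfold MatTup.act MatTup.nsum
    simp only [MatTup.mk.injEq, heq_eq_eq, true_and]
    rw [funext_iff]
    refine forall_congr' fun l => ?_
    rw [hinv]
    constructor
    · intro h
      conv_rhs => rw [← h]
      rw [mul_assoc, hW', mul_one]
    · intro h
      rw [h, mul_assoc, hW, mul_one]
  ext W
  refine (hstab W).trans ?_
  change _ ↔ ∃ U ∈ Matrix.unitaryGroup (Fin n) ℂ,
        W = Matrix.reindex finProdFinEquiv finProdFinEquiv
          (Matrix.kroneckerMap (· * ·) (1 : Matrix (Fin X.deg) (Fin X.deg) ℂ) U)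
  obtain ⟨W, rfl⟩ := (Matrix.reindexAlgEquiv ℂ ℂ (finProdFinEquiv (m := X.deg) (n := n))).surjective W
  have hst : star (Matrix.reindexAlgEquiv ℂ ℂ (finProdFinEquiv (m := X.deg) (n := n)) W) =
      Matrix.reindexAlgEquiv ℂ ℂ (finProdFinEquiv (m := X.deg) (n := n)) (star W) := rfl
  simp only [← Matrix.reindexAlgEquiv_apply ℂ ℂ]
  rw [hst]
  simp only [← map_mul, EmbeddingLike.apply_eq_iff_eq, EmbeddingLike.map_eq_one_iff]
  constructor
  · rintro ⟨hW, h⟩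
    obtain ⟨U, hU, hWU⟩ := aux_main X hX n W hW h
    exact ⟨U, hU, by rw [hWU]⟩
  · rintro ⟨U, hU, hWU⟩
    obtain rfl := (Matrix.reindexAlgEquiv ℂ ℂ (finProdFinEquiv (m := X.deg) (n := n))).injective hWU
    rw [Matrix.mem_unitaryGroup_iff] at hU
    constructor
    · have h1 : star (Matrix.kroneckerMap (· * ·) (1 : Matrix (Fin X.deg) (Fin X.deg) ℂ) U) =
          Matrix.kroneckerMap (· * ·) (1 : Matrix (Fin X.deg) (Fin X.deg) ℂ) (star U) := by
        have := Matrix.conjTranspose_kronecker (1 : Matrix (Fin X.deg) (Fin X.deg) ℂ) U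
        rw [Matrix.conjTranspose_one] at this
        exact this
      rw [h1, ← Matrix.mul_kronecker_mul, hU, one_mul, Matrix.one_kronecker_one]
    · intro l
      rw [← Matrix.kronecker_one, ← Matrix.mul_kronecker_mul, ← Matrix.mul_kronecker_mul]
      simp
end
end

section
/- Let T_1, …, T_n be irreducible tuples of complex matrices over an index set Λ. If X is a tuple with X ≼ T_1 ⊕ ⋯ ⊕ T_n, then there exists a nonempty subset J ⊆ {1,…,n} such that X ≡ ⊕_{j∈J} T_j (the direct sum taken in increasing order of the indices in J). -/
noncomputable section

open Matrix
open scoped ComplexOrder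

namespace MatTup

/-- Unitary intertwiner form of unitary equivalence. -/
theorem UEquiv_iff {Λ : Type*} (X Y : MatTup Λ) : X.UEquiv Y ↔
    ∃ U : Matrix (Fin Y.deg) (Fin X.deg) ℂ, Uᴴ * U = 1 ∧ U * Uᴴ = 1 ∧
      ∀ l, U * X.mat l = Y.mat l * U := by
  constructor
  · rintro ⟨U, hU, rfl⟩
    have h1 : Uᴴ * U = 1 := (Matrix.mem_unitaryGroup_iff').1 hU
    have h2 : U * Uᴴ = 1 := (Matrix.mem_unitaryGroup_iff).1 hU
    have h3 : U⁻¹ = Uᴴ := Matrix.inv_eq_left_inv h1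
    refine ⟨U, h1, h2, fun l => ?_⟩
    show U * X.mat l = U * X.mat l * U⁻¹ * U
    rw [h3, Matrix.mul_assoc _ Uᴴ U, h1, Matrix.mul_one]
  · rintro ⟨U, h1, h2, h3⟩
    obtain ⟨a, ha, x⟩ := X
    obtain ⟨b, hb, y⟩ := Y
    dsimp only at U h1 h2 h3
    have hab : a = b := by
      have := Matrix.trace_mul_comm Uᴴ U
      rw [h1, h2, Matrix.trace_one, Matrix.trace_one] at this
      simpa using this
    subst hab
    refine ⟨U, (Matrix.mem_unitaryGroup_iff).2 h2, ?_⟩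
    have h4 : U⁻¹ = Uᴴ := Matrix.inv_eq_left_inv h1
    simp only [act, MatTup.mk.injEq, heq_eq_eq, true_and]
    funext l
    show U * x l * U⁻¹ = y l
    rw [h4, h3 l, Matrix.mul_assoc, h2, Matrix.mul_one]

theorem UEquiv.trans {Λ : Type*} {X Y Z : MatTup Λ} (h : X.UEquiv Y) (h' : Y.UEquiv Z) :
    X.UEquiv Z := by
  rw [UEquiv_iff] at *
  obtain ⟨U, a, b, c⟩ := h
  obtain ⟨V, a', b', c'⟩ := h'
  refine ⟨V * U, ?_, ?_, fun l => ?_⟩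
  · rw [conjTranspose_mul, Matrix.mul_assoc, ← Matrix.mul_assoc Vᴴ, a', Matrix.one_mul, a]
  · rw [conjTranspose_mul, Matrix.mul_assoc, ← Matrix.mul_assoc U, b, Matrix.one_mul, b']
  · rw [Matrix.mul_assoc, c, ← Matrix.mul_assoc, c', Matrix.mul_assoc]

/-- The index equivalence of a direct sum. -/
def eqv {Λ : Type*} (A B : MatTup Λ) : Fin A.deg ⊕ Fin B.deg ≃ Fin (A.dsum B).deg :=
  finSumFinEquiv

theorem dsum_mat_eq {Λ : Type*} (A B : MatTup Λ) (l : Λ) : (A.dsum B).mat l =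
    (fromBlocks (A.mat l) 0 0 (B.mat l)).submatrix (eqv A B).symm (eqv A B).symm := rfl

/-- Building an equivalence with a direct sum from two rows. -/
theorem UEquiv_dsum {Λ : Type*} (X A B : MatTup Λ)
    (V : Matrix (Fin A.deg) (Fin X.deg) ℂ) (W : Matrix (Fin B.deg) (Fin X.deg) ℂ)
    (hV : V * Vᴴ = 1) (hW : W * Wᴴ = 1) (hVW : V * Wᴴ = 0) (hs : Vᴴ * V + Wᴴ * W = 1)
    (hA : ∀ l, V * X.mat l = A.mat l * V) (hB : ∀ l, W * X.mat l = B.mat l * W) :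
    X.UEquiv (A.dsum B) := by
  rw [UEquiv_iff]
  have hWV : W * Vᴴ = 0 := by
    have := congrArg conjTranspose hVW
    simpa using this
  refine ⟨(fromRows V W).submatrix (eqv A B).symm id, ?_, ?_, fun l => ?_⟩
  · rw [conjTranspose_submatrix, submatrix_mul_equiv,
      conjTranspose_fromRows_eq_fromCols_conjTranspose,
      fromCols_mul_fromRows, hs, submatrix_id_id]
  · rw [conjTranspose_submatrix]
    rw [← Matrix.submatrix_mul _ _ _ id _ Function.bijective_id,
      conjTranspose_fromRows_eq_fromCols_conjTranspose, fromRows_mul_fromCols, hV, hW, hVW, hWV,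
      fromBlocks_one]
    exact Matrix.submatrix_one_equiv _
  · have e1 : (fromRows V W).submatrix (eqv A B).symm id * X.mat l =
      ((fromRows V W) * X.mat l).submatrix (eqv A B).symm id := rfl
    rw [e1, dsum_mat_eq, submatrix_mul_equiv, fromBlocks_mul_fromRows, fromRows_mul]
    simp [hA, hB]

theorem dsum_mat {Λ : Type*} (A B : MatTup Λ) (l : Λ) {c : Type*}
    (S : Matrix (Fin (A.dsum B).deg) c ℂ) :
    ((A.dsum B).mat l * S).submatrix (eqv A B) id
      = fromRows (A.mat l * (S.submatrix (eqv A B) id).toRows₁)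
        (B.mat l * (S.submatrix (eqv A B) id).toRows₂) := by
  obtain ⟨R, hS⟩ : ∃ R : Matrix (Fin A.deg ⊕ Fin B.deg) c ℂ,
      S = R.submatrix (eqv A B).symm id :=
    ⟨S.submatrix (eqv A B) id, by ext i j; simp⟩
  have hR : S.submatrix (eqv A B) id = R := by rw [hS]; ext i j; simp
  rw [hR, hS, dsum_mat_eq, submatrix_mul_equiv]
  conv_lhs => rw [← fromRows_toRows R, fromBlocks_mul_fromRows]
  ext i j
  simp

theorem dsum_matH {Λ : Type*} (A B : MatTup Λ) (l : Λ) {c : Type*}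
    (S : Matrix (Fin (A.dsum B).deg) c ℂ) :
    (((A.dsum B).mat l)ᴴ * S).submatrix (eqv A B) id
      = fromRows ((A.mat l)ᴴ * (S.submatrix (eqv A B) id).toRows₁)
        ((B.mat l)ᴴ * (S.submatrix (eqv A B) id).toRows₂) := by
  obtain ⟨R, hS⟩ : ∃ R : Matrix (Fin A.deg ⊕ Fin B.deg) c ℂ,
      S = R.submatrix (eqv A B).symm id :=
    ⟨S.submatrix (eqv A B) id, by ext i j; simp⟩
  have hR : S.submatrix (eqv A B) id = R := by rw [hS]; ext i j; simp
  rw [hR, hS, dsum_mat_eq, conjTranspose_submatrix, submatrix_mul_equiv, fromBlocks_conjTranspose]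
  conv_lhs => rw [← fromRows_toRows R, fromBlocks_mul_fromRows]
  ext i j
  simp

/-- Isometric `*`-intertwiner. -/
def Emb {Λ : Type*} (A B : MatTup Λ) : Prop :=
  ∃ S : Matrix (Fin B.deg) (Fin A.deg) ℂ, Sᴴ * S = 1 ∧ (∀ l, S * A.mat l = B.mat l * S) ∧
    ∀ l, S * (A.mat l)ᴴ = (B.mat l)ᴴ * S

theorem rows_dsum {Λ : Type*} {A B C : MatTup Λ}
    (S : Matrix (Fin (B.dsum C).deg) (Fin A.deg) ℂ)
    (h2 : ∀ l, S * A.mat l = (B.dsum C).mat l * S)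
    (h3 : ∀ l, S * (A.mat l)ᴴ = ((B.dsum C).mat l)ᴴ * S) :
    ∃ (P : Matrix (Fin B.deg) (Fin A.deg) ℂ) (R : Matrix (Fin C.deg) (Fin A.deg) ℂ),
      Sᴴ * S = Pᴴ * P + Rᴴ * R ∧
      (S * Sᴴ = 1 → P * Pᴴ = 1 ∧ R * Rᴴ = 1 ∧ P * Rᴴ = 0) ∧
      (∀ l, P * A.mat l = B.mat l * P) ∧ (∀ l, P * (A.mat l)ᴴ = (B.mat l)ᴴ * P) ∧
      (∀ l, R * A.mat l = C.mat l * R) ∧ (∀ l, R * (A.mat l)ᴴ = (C.mat l)ᴴ * R) := by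
  set Q := S.submatrix (eqv B C) id with hQ
  have k2 := fun l => congrArg (fun M => M.submatrix (eqv B C) id) (h2 l)
  have k3 := fun l => congrArg (fun M => M.submatrix (eqv B C) id) (h3 l)
  simp only [dsum_mat, dsum_matH] at k2 k3
  have e : ∀ M : Matrix (Fin A.deg) (Fin A.deg) ℂ,
    (S * M).submatrix (eqv B C) id =
      fromRows (Q.toRows₁ * M) (Q.toRows₂ * M) := by
    intro M
    rw [← fromRows_mul, fromRows_toRows]; rfl
  simp only [e, ← hQ] at k2 k3
  refine ⟨Q.toRows₁, Q.toRows₂, ?_, fun h => ?_, fun l => (fromRows_inj (k2 l)).1,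
    fun l => (fromRows_inj (k3 l)).1, fun l => (fromRows_inj (k2 l)).2,
    fun l => (fromRows_inj (k3 l)).2⟩
  · rw [← fromCols_mul_fromRows, ← conjTranspose_fromRows_eq_fromCols_conjTranspose,
      fromRows_toRows, hQ]
    ext i j
    simp only [Matrix.mul_apply, conjTranspose_apply, submatrix_apply, id]
    exact (Equiv.sum_comp (eqv B C) (fun x => star (S x i) * S x j)).symm
  · have key : ∀ a b, (S * Sᴴ) (eqv B C a) (eqv B C b) = if a = b then 1 else 0 := by
      intro a b
      rw [h, Matrix.one_apply]
      simp
    refine ⟨?_, ?_, ?_⟩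
    · ext i j
      have := key (Sum.inl i) (Sum.inl j)
      simpa [Matrix.mul_apply, hQ, toRows₁, Matrix.one_apply] using this
    · ext i j
      have := key (Sum.inr i) (Sum.inr j)
      simpa [Matrix.mul_apply, hQ, toRows₂, Matrix.one_apply] using this
    · ext i j
      have := key (Sum.inl i) (Sum.inr j)
      simpa [Matrix.mul_apply, hQ, toRows₁, toRows₂] using this

theorem UEquiv.matH {Λ : Type*} {X Y : MatTup Λ} {U : Matrix (Fin Y.deg) (Fin X.deg) ℂ}
    (h1 : Uᴴ * U = 1) (h2 : U * Uᴴ = 1) (h3 : ∀ l, U * X.mat l = Y.mat l * U) (l : Λ) :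
    U * (X.mat l)ᴴ = (Y.mat l)ᴴ * U := by
  have e : (X.mat l)ᴴ * Uᴴ = Uᴴ * (Y.mat l)ᴴ := by
    have := congrArg conjTranspose (h3 l)
    simpa [conjTranspose_mul] using this
  calc U * (X.mat l)ᴴ = U * ((X.mat l)ᴴ * Uᴴ) * U := by
        simp only [Matrix.mul_assoc, h1, Matrix.mul_one]
    _ = (U * Uᴴ) * (Y.mat l)ᴴ * U := by rw [e]; simp only [Matrix.mul_assoc]
    _ = _ := by rw [h2, Matrix.one_mul]

theorem Emb.comp {Λ : Type*} {X Y Z : MatTup Λ} (h : X.Emb Y) (h' : Y.Emb Z) : X.Emb Z := by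
  obtain ⟨U, a, b, c⟩ := h
  obtain ⟨V, a', b', c'⟩ := h'
  refine ⟨V * U, ?_, fun l => ?_, fun l => ?_⟩
  · rw [conjTranspose_mul, Matrix.mul_assoc, ← Matrix.mul_assoc Vᴴ, a', Matrix.one_mul, a]
  · rw [Matrix.mul_assoc, b, ← Matrix.mul_assoc, b', Matrix.mul_assoc]
  · rw [Matrix.mul_assoc, c, ← Matrix.mul_assoc, c', Matrix.mul_assoc]

theorem UEquiv.emb {Λ : Type*} {X Y : MatTup Λ} (h : X.UEquiv Y) : X.Emb Y := by
  obtain ⟨U, h1, h2, h3⟩ := (UEquiv_iff _ _).1 h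
  exact ⟨U, h1, h3, UEquiv.matH h1 h2 h3⟩

theorem Sub.emb {Λ : Type*} {X Y : MatTup Λ} (h : X.Sub Y) : X.Emb Y := by
  obtain h | ⟨A, B, hX, hY⟩ := h
  · exact h.emb
  · refine hX.emb.comp ?_
    obtain ⟨U, h1, h2, h3⟩ := (UEquiv_iff _ _).1 hY
    obtain ⟨P, R, -, k1, k2, k3, -, -⟩ := rows_dsum U h3 (UEquiv.matH h1 h2 h3)
    refine ⟨Pᴴ, ?_, fun l => ?_, fun l => ?_⟩
    · rw [conjTranspose_conjTranspose]; exact (k1 h2).1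
    · have := congrArg conjTranspose (k3 l)
      simpa [conjTranspose_mul] using this.symm
    · have := congrArg conjTranspose (k2 l)
      simpa [conjTranspose_mul] using this.symm

theorem UEquiv.dsum_left {Λ : Type*} {X K K' T : MatTup Λ} (h : X.UEquiv (K.dsum T))
    (hK : K.UEquiv K') : X.UEquiv (K'.dsum T) := by
  obtain ⟨U, h1, h2, h3⟩ := (UEquiv_iff _ _).1 h
  obtain ⟨P, R, k0, k1, k2, k3, k4, k5⟩ := rows_dsum U h3 (UEquiv.matH h1 h2 h3)
  obtain ⟨a, b, c⟩ := k1 h2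
  obtain ⟨V, g1, g2, g3⟩ := (UEquiv_iff _ _).1 hK
  refine UEquiv_dsum _ _ _ (V * P) R ?_ b ?_ ?_ ?_ k4
  · rw [conjTranspose_mul, Matrix.mul_assoc, ← Matrix.mul_assoc P, a, Matrix.one_mul, g2]
  · rw [Matrix.mul_assoc, c, Matrix.mul_zero]
  · rw [conjTranspose_mul, Matrix.mul_assoc, ← Matrix.mul_assoc Vᴴ, g1, Matrix.one_mul, ← k0, h1]
  · intro l
    rw [Matrix.mul_assoc, k2, ← Matrix.mul_assoc, g3, Matrix.mul_assoc]

theorem spec {n : Type*} [Fintype n] [DecidableEq n] (H : Matrix n n ℂ)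
    (hH : H.IsHermitian) : ∃ (W : Matrix n n ℂ) (d : n → ℝ), Wᴴ * W = 1 ∧ W * Wᴴ = 1 ∧
      H = W * diagonal (fun i => (d i : ℂ)) * Wᴴ := by
  refine ⟨hH.eigenvectorUnitary, hH.eigenvalues, ?_, ?_, ?_⟩
  · exact Unitary.coe_star_mul_self hH.eigenvectorUnitary
  · exact Unitary.coe_mul_star_self hH.eigenvectorUnitary
  · exact hH.spectral_theorem

theorem conj_inj {n : Type*} [Fintype n] [DecidableEq n] {W A B : Matrix n n ℂ}
    (h1 : Wᴴ * W = 1) (h : W * A * Wᴴ = W * B * Wᴴ) : A = B := by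
  have : ∀ A : Matrix n n ℂ, Wᴴ * (W * A * Wᴴ) * W = A := by
    intro A
    calc Wᴴ * (W * A * Wᴴ) * W = (Wᴴ * W) * A * (Wᴴ * W) := by simp only [Matrix.mul_assoc]
      _ = A := by rw [h1, Matrix.one_mul, Matrix.mul_one]
  rw [← this A, h, this B]

theorem conj_mul {n : Type*} [Fintype n] [DecidableEq n] {W : Matrix n n ℂ}
    (h1 : Wᴴ * W = 1) (A B : Matrix n n ℂ) :
    (W * A * Wᴴ) * (W * B * Wᴴ) = W * (A * B) * Wᴴ := by
  calc (W * A * Wᴴ) * (W * B * Wᴴ) = W * A * (Wᴴ * W) * B * Wᴴ := by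
        simp only [Matrix.mul_assoc]
    _ = _ := by rw [h1]; simp only [Matrix.mul_assoc, Matrix.one_mul]

/-- An orthogonal projection factors through an isometry. -/
theorem exists_factor {n : Type*} [Fintype n] [DecidableEq n] (P : Matrix n n ℂ)
    (hP : P.IsHermitian) (hPP : P * P = P) :
    ∃ (k : ℕ) (V : Matrix (Fin k) n ℂ), V * Vᴴ = 1 ∧ Vᴴ * V = P := by
  obtain ⟨W, d, h1, h2, h3⟩ := spec P hP
  have hd : ∀ i, d i = 1 ∨ d i = 0 := by
    intro i
    rw [h3, conj_mul h1] at hPP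
    have := congrFun (congrFun (conj_inj h1 hPP) i) i
    rw [diagonal_mul_diagonal, diagonal_apply_eq, diagonal_apply_eq] at this
    have h : d i * d i = d i := by exact_mod_cast this
    by_cases h0 : d i = 0
    · exact Or.inr h0
    · exact Or.inl (mul_left_cancel₀ h0 (by rw [h, mul_one]))
  let e := Fintype.equivFin {i // d i = 1}
  refine ⟨_, (Wᴴ).submatrix (fun a => (e.symm a).1) id, ?_, ?_⟩
  · rw [conjTranspose_submatrix, ← Matrix.submatrix_mul _ _ _ id _ Function.bijective_id,
      conjTranspose_conjTranspose, h1]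
    exact submatrix_one _ (Subtype.val_injective.comp e.symm.injective)
  · rw [h3]
    ext j k
    rw [Matrix.mul_apply, Matrix.mul_apply]
    simp only [mul_diagonal, conjTranspose_apply, submatrix_apply, id, star_star]
    rw [Equiv.sum_comp e.symm (fun x : {i // d i = 1} => W j x.1 * star (W k x.1)),
      ← Finset.sum_subtype (Finset.univ.filter fun i => d i = 1) (by simp)
        (fun x => W j x * star (W k x)), Finset.sum_filter]
    refine Finset.sum_congr rfl fun i _ => ?_
    obtain h | h := hd i <;> simp [h]

/-- The corner of a tuple by a commuting orthogonal projection. -/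
theorem exists_corner {Λ : Type*} (X : MatTup Λ) (P : Matrix (Fin X.deg) (Fin X.deg) ℂ)
    (hP : P.IsHermitian) (hPP : P * P = P) (hc : ∀ l, P * X.mat l = X.mat l * P) :
    ∃ (k : ℕ) (V : Matrix (Fin k) (Fin X.deg) ℂ), V * Vᴴ = 1 ∧ Vᴴ * V = P ∧ V * P = V ∧
      (∀ l, V * X.mat l = (V * X.mat l * Vᴴ) * V) ∧
      (∀ l, V * (X.mat l)ᴴ = (V * X.mat l * Vᴴ)ᴴ * V) := by
  obtain ⟨k, V, h1, h2⟩ := exists_factor P hP hPP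
  have h3 : V * P = V := by rw [← h2, ← Matrix.mul_assoc, h1, Matrix.one_mul]
  refine ⟨k, V, h1, h2, h3, fun l => ?_, fun l => ?_⟩
  · rw [Matrix.mul_assoc _ Vᴴ, h2, Matrix.mul_assoc, ← hc, ← Matrix.mul_assoc, h3]
  · have e : P * (X.mat l)ᴴ = (X.mat l)ᴴ * P := by
      have := congrArg conjTranspose (hc l)
      rw [conjTranspose_mul, conjTranspose_mul, hP.eq] at this
      exact this.symm
    rw [conjTranspose_mul, conjTranspose_mul, conjTranspose_conjTranspose, Matrix.mul_assoc,
      Matrix.mul_assoc, h2, ← e, ← Matrix.mul_assoc, h3]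

/-- A commuting orthogonal projection of an irreducible tuple is trivial. -/
theorem Irred.proj {Λ : Type*} {T : MatTup Λ} (hT : T.Irred)
    (P : Matrix (Fin T.deg) (Fin T.deg) ℂ)
    (hP : P.IsHermitian) (hPP : P * P = P) (hc : ∀ l, P * T.mat l = T.mat l * P) :
    P = 0 ∨ P = 1 := by
  obtain ⟨k, V, a1, a2, a3, a4, -⟩ := exists_corner T P hP hPP hc
  obtain ⟨k', V', b1, b2, b3, b4, -⟩ := exists_corner T (1 - P)
    (isHermitian_one.sub hP) (by simp [Matrix.mul_sub, Matrix.sub_mul, hPP])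
    (by intro l; simp [Matrix.mul_sub, Matrix.sub_mul, hc])
  rcases Nat.eq_zero_or_pos k with rfl | hk
  · left; rw [← a2]; ext i j; simp [Matrix.mul_apply]
  rcases Nat.eq_zero_or_pos k' with rfl | hk'
  · right
    have : 1 - P = 0 := by rw [← b2]; ext i j; simp [Matrix.mul_apply]
    exact (sub_eq_zero.1 this).symm
  exfalso
  have hVV : V * V'ᴴ = 0 := by
    have e1 : (1 - P) * V'ᴴ = V'ᴴ := by
      have := congrArg conjTranspose b3
      rwa [conjTranspose_mul, (isHermitian_one.sub hP).eq] at this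
    rw [← e1, ← Matrix.mul_assoc, Matrix.mul_sub, a3, Matrix.mul_one, sub_self, Matrix.zero_mul]
  obtain ⟨U, hU, h⟩ := UEquiv_dsum T ⟨k, hk, fun l => V * T.mat l * Vᴴ⟩
    ⟨k', hk', fun l => V' * T.mat l * V'ᴴ⟩ V V' a1 b1 hVV (by rw [a2, b2]; simp) a4 b4
  exact hT ⟨_, _, U, hU, h⟩

theorem Irred.schur {Λ : Type*} {T : MatTup Λ} (hT : T.Irred)
    (H : Matrix (Fin T.deg) (Fin T.deg) ℂ)
    (hH : H.IsHermitian) (hc : ∀ l, H * T.mat l = T.mat l * H) :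
    ∃ c : ℝ, H = (c : ℂ) • 1 := by
  obtain ⟨W, d, h1, h2, h3⟩ := spec H hH
  let c := d ⟨0, T.deg_pos⟩
  let ε : Fin T.deg → ℂ := fun i => if d i = c then 1 else 0
  have hM : ∀ l, ∃ M, T.mat l = W * M * Wᴴ := by
    intro l
    refine ⟨Wᴴ * T.mat l * W, ?_⟩
    calc T.mat l = (W * Wᴴ) * T.mat l * (W * Wᴴ) := by rw [h2, Matrix.one_mul, Matrix.mul_one]
      _ = _ := by simp only [Matrix.mul_assoc]
  refine ⟨c, ?_⟩
  have key := hT.proj (W * diagonal ε * Wᴴ) ?_ ?_ ?_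
  · have hE : diagonal ε = 1 := by
      rcases key with h | h
      · exfalso
        have : diagonal ε = 0 := conj_inj h1 (by rw [h]; simp)
        have := congrFun (congrFun this ⟨0, T.deg_pos⟩) ⟨0, T.deg_pos⟩
        rw [diagonal_apply_eq] at this
        simp [ε, c] at this
      · exact conj_inj h1 (by rw [h, Matrix.mul_one, h2])
    have hd : ∀ i, d i = c := by
      intro i
      have := congrFun (congrFun hE i) i
      rw [diagonal_apply_eq, one_apply_eq] at this
      by_contra hne
      simp [ε, hne] at this
    have : diagonal (fun i => (d i : ℂ)) = (c : ℂ) • (1 : Matrix (Fin T.deg) (Fin T.deg) ℂ) := by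
      simp only [hd]
      rw [smul_one_eq_diagonal]
    rw [h3, this]
    simp [h2]
  · apply isHermitian_mul_mul_conjTranspose
    rw [IsHermitian, diagonal_conjTranspose]
    congr 1
    ext i
    simp only [Pi.star_apply, ε]
    split_ifs <;> simp
  · rw [conj_mul h1, diagonal_mul_diagonal]
    congr 3
    ext i
    simp [ε]
  · intro l
    obtain ⟨M, hMl⟩ := hM l
    have := hc l
    rw [hMl, h3, conj_mul h1, conj_mul h1] at this
    have hcm := conj_inj h1 this
    rw [hMl, conj_mul h1, conj_mul h1]
    congr 2
    ext i j
    have hij := congrFun (congrFun hcm i) j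
    rw [diagonal_mul, mul_diagonal] at hij ⊢
    by_cases h0 : M i j = 0
    · simp [h0]
    · have : (d i : ℂ) = d j := by
        rw [mul_comm] at hij
        exact mul_left_cancel₀ h0 hij
      have : d i = d j := by exact_mod_cast this
      simp only [ε, this]
      ring

theorem comm_of_intertwine {Λ : Type*} {A T : MatTup Λ}
    {R : Matrix (Fin T.deg) (Fin A.deg) ℂ}
    (h1 : ∀ l, R * A.mat l = T.mat l * R) (h2 : ∀ l, R * (A.mat l)ᴴ = (T.mat l)ᴴ * R) (l : Λ) :
    A.mat l * Rᴴ = Rᴴ * T.mat l := by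
  have := congrArg conjTranspose (h2 l)
  simpa [conjTranspose_mul] using this

theorem Irred.coisometry {Λ : Type*} {A T : MatTup Λ} (hT : T.Irred)
    {R : Matrix (Fin T.deg) (Fin A.deg) ℂ}
    (h1 : ∀ l, R * A.mat l = T.mat l * R) (h2 : ∀ l, R * (A.mat l)ᴴ = (T.mat l)ᴴ * R) :
    R = 0 ∨ ∃ t : ℝ, t ≠ 0 ∧ ((t : ℂ) • R) * ((t : ℂ) • R)ᴴ = 1 := by
  obtain ⟨c, hc⟩ := hT.schur (R * Rᴴ) (isHermitian_mul_conjTranspose_self R) (by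
    intro l
    rw [Matrix.mul_assoc, ← comm_of_intertwine h1 h2, ← Matrix.mul_assoc, h1, Matrix.mul_assoc])
  have hc0 : 0 ≤ c := by
    have h := congrFun (congrFun hc ⟨0, T.deg_pos⟩) ⟨0, T.deg_pos⟩
    have hn := (posSemidef_self_mul_conjTranspose R).diag_nonneg (i := ⟨0, T.deg_pos⟩)
    rw [h] at hn
    simpa using hn
  rcases hc0.eq_or_lt with h | h
  · left
    rw [← h, Complex.ofReal_zero, zero_smul] at hc
    exact self_mul_conjTranspose_eq_zero.1 hc
  · right
    have hs : Real.sqrt c ≠ 0 := (Real.sqrt_pos.2 h).ne'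
    refine ⟨(Real.sqrt c)⁻¹, inv_ne_zero hs, ?_⟩
    rw [conjTranspose_smul, Matrix.smul_mul, Matrix.mul_smul, hc, smul_smul, smul_smul]
    have : ((((Real.sqrt c)⁻¹ : ℝ) : ℂ) * (star (((Real.sqrt c)⁻¹ : ℝ) : ℂ) * (c : ℂ))) = 1 := by
      have e : star (((Real.sqrt c)⁻¹ : ℝ) : ℂ) = (((Real.sqrt c)⁻¹ : ℝ) : ℂ) :=
        Complex.conj_ofReal _
      rw [e]
      norm_cast
      rw [← mul_assoc, ← mul_inv, Real.mul_self_sqrt hc0, inv_mul_cancel₀ h.ne']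
    rw [← mul_assoc] at this
    rw [this, one_smul]

theorem ne_zero_of_isometry {Λ : Type*} {A : MatTup Λ} {m : Type*} [Fintype m]
    {R : Matrix m (Fin A.deg) ℂ} (h : Rᴴ * R = 1) : R ≠ 0 := by
  rintro rfl
  have := congrFun (congrFun h ⟨0, A.deg_pos⟩) ⟨0, A.deg_pos⟩
  simp at this

/-- The inductive step. -/
theorem step {Λ : Type*} {A T : MatTup Λ} (hT : T.Irred) {m : Type*} [Fintype m]
    (Y : Λ → Matrix m m ℂ) (P : Matrix m (Fin A.deg) ℂ) (R : Matrix (Fin T.deg) (Fin A.deg) ℂ)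
    (h0 : Pᴴ * P + Rᴴ * R = 1)
    (p1 : ∀ l, P * A.mat l = Y l * P) (p2 : ∀ l, P * (A.mat l)ᴴ = (Y l)ᴴ * P)
    (h1 : ∀ l, R * A.mat l = T.mat l * R) (h2 : ∀ l, R * (A.mat l)ᴴ = (T.mat l)ᴴ * R) :
    Pᴴ * P = 1 ∨ A.UEquiv T ∨ ∃ K : MatTup Λ, A.UEquiv (K.dsum T) ∧
      ∃ S : Matrix m (Fin K.deg) ℂ, Sᴴ * S = 1 ∧ (∀ l, S * K.mat l = Y l * S) ∧
        ∀ l, S * (K.mat l)ᴴ = (Y l)ᴴ * S := by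
  rcases hT.coisometry h1 h2 with rfl | ⟨t, ht, hU⟩
  · left; simpa using h0
  right
  set U := (t : ℂ) • R with hUdef
  have u1 : ∀ l, U * A.mat l = T.mat l * U := fun l => by
    rw [hUdef, Matrix.smul_mul, h1, Matrix.mul_smul]
  have u2 : ∀ l, U * (A.mat l)ᴴ = (T.mat l)ᴴ * U := fun l => by
    rw [hUdef, Matrix.smul_mul, h2, Matrix.mul_smul]
  have hUU : (Uᴴ * U) * (Uᴴ * U) = Uᴴ * U := by
    rw [Matrix.mul_assoc, ← Matrix.mul_assoc U, hU, Matrix.one_mul]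
  have hUc : ∀ l, Uᴴ * U * A.mat l = A.mat l * (Uᴴ * U) := fun l => by
    rw [Matrix.mul_assoc, u1, ← Matrix.mul_assoc, ← comm_of_intertwine u1 u2, Matrix.mul_assoc]
  obtain ⟨k, V, a1, a2, a3, a4, a5⟩ := exists_corner A (1 - Uᴴ * U)
    (isHermitian_one.sub (isHermitian_conjTranspose_mul_self U))
    (by simp [Matrix.mul_sub, Matrix.sub_mul, hUU])
    (by intro l; rw [Matrix.mul_sub, Matrix.sub_mul, hUc]; simp)
  rcases Nat.eq_zero_or_pos k with rfl | hk
  · left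
    have : 1 - Uᴴ * U = 0 := by rw [← a2]; ext i j; simp [Matrix.mul_apply]
    exact (UEquiv_iff _ _).2 ⟨U, (sub_eq_zero.1 this).symm, hU, u1⟩
  right
  have hVU : V * Uᴴ = 0 := by
    have : V * (Uᴴ * U) = 0 := by
      rw [Matrix.mul_sub, Matrix.mul_one] at a3
      simpa using a3
    calc V * Uᴴ = V * (Uᴴ * U) * Uᴴ := by simp only [Matrix.mul_assoc, hU, Matrix.mul_one]
      _ = 0 := by rw [this, Matrix.zero_mul]
  have hRV : R * Vᴴ = 0 := by
    have := congrArg conjTranspose hVU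
    rw [conjTranspose_mul, conjTranspose_conjTranspose, conjTranspose_zero, hUdef,
      Matrix.smul_mul] at this
    exact (smul_eq_zero.1 this).resolve_left (by exact_mod_cast ht)
  refine ⟨⟨k, hk, fun l => V * A.mat l * Vᴴ⟩, ?_, P * Vᴴ, ?_, fun l => ?_, fun l => ?_⟩
  · exact UEquiv_dsum A ⟨k, hk, fun l => V * A.mat l * Vᴴ⟩ T V U a1 hU hVU
      (by rw [a2]; simp) a4 u1
  · show (P * Vᴴ)ᴴ * (P * Vᴴ) = 1
    have e : Pᴴ * P = 1 - Rᴴ * R := eq_sub_of_add_eq h0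
    rw [conjTranspose_mul, conjTranspose_conjTranspose, Matrix.mul_assoc, ← Matrix.mul_assoc Pᴴ,
      e, Matrix.sub_mul, Matrix.one_mul, Matrix.mul_assoc, hRV, Matrix.mul_zero, sub_zero, a1]
  · have e := congrArg conjTranspose (a5 l)
    rw [conjTranspose_mul, conjTranspose_mul, conjTranspose_conjTranspose,
      conjTranspose_conjTranspose] at e
    show P * Vᴴ * (V * A.mat l * Vᴴ) = Y l * (P * Vᴴ)
    rw [Matrix.mul_assoc, ← e, ← Matrix.mul_assoc, p1, Matrix.mul_assoc]
  · have e := congrArg conjTranspose (a4 l)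
    rw [conjTranspose_mul, conjTranspose_mul] at e
    show P * Vᴴ * (V * A.mat l * Vᴴ)ᴴ = (Y l)ᴴ * (P * Vᴴ)
    rw [Matrix.mul_assoc, ← e, ← Matrix.mul_assoc, p2, Matrix.mul_assoc]

theorem Irred.uequiv_of_emb {Λ : Type*} {A T : MatTup Λ} (hT : T.Irred) (h : A.Emb T) :
    A.UEquiv T := by
  obtain ⟨R, h0, h1, h2⟩ := h
  rcases step hT (fun _ => (0 : Matrix (Fin 0) (Fin 0) ℂ)) 0 R (by simpa using h0)
    (by simp) (by simp) h1 h2 with h | h | ⟨K, -, S, h, -⟩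
  · exact absurd rfl (ne_zero_of_isometry (A := A) h)
  · exact h
  · exact absurd (Subsingleton.elim _ _) (ne_zero_of_isometry (A := K) h)

theorem Irred.emb_dsum {Λ : Type*} {A B T : MatTup Λ} (hT : T.Irred) (h : A.Emb (B.dsum T)) :
    A.Emb B ∨ A.UEquiv T ∨ ∃ K : MatTup Λ, A.UEquiv (K.dsum T) ∧ K.Emb B := by
  obtain ⟨S, h0, h1, h2⟩ := h
  obtain ⟨P, R, k0, -, k1, k2, k3, k4⟩ := rows_dsum S h1 h2
  rcases step hT B.mat P R (k0 ▸ h0) k1 k2 k3 k4 with h | h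
  · exact Or.inl ⟨P, h, k1, k2⟩
  · exact Or.inr h

theorem main {Λ : Type*} (n : ℕ) : ∀ (T : Fin (n + 1) → MatTup Λ), (∀ j, (T j).Irred) →
    ∀ (X : MatTup Λ), X.Emb (bigDsum T n.succ_pos) →
    ∃ (m : ℕ) (g : Fin (m + 1) → Fin (n + 1)), StrictMono g ∧
      X.UEquiv (bigDsum (fun i => T (g i)) m.succ_pos) := by
  induction n with
  | zero =>
    intro T hT X h
    exact ⟨0, id, strictMono_id, (hT 0).uequiv_of_emb h⟩
  | succ n ih =>
    intro T hT X h
    rcases (hT (Fin.last (n + 1))).emb_dsum (B := bigDsum (fun j => T j.castSucc) n.succ_pos) h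
      with h | h | ⟨K, h, hK⟩
    · obtain ⟨m, g, hg, hX⟩ := ih _ (fun j => hT _) X h
      exact ⟨m, fun i => (g i).castSucc, (Fin.strictMono_castSucc).comp hg, hX⟩
    · exact ⟨0, fun _ => Fin.last (n + 1), by intro i j hij; omega, h⟩
    · obtain ⟨m, g, hg, hX⟩ := ih _ (fun j => hT _) K hK
      refine ⟨m + 1, Fin.snoc (α := fun _ => Fin (n + 2)) (fun i => (g i).castSucc)
        (Fin.last (n + 1)), ?_, ?_⟩
      · intro i j hij
        induction j using Fin.lastCases with
        | last =>
          induction i using Fin.lastCases with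
          | last => exact absurd hij (lt_irrefl _)
          | cast i => simp
        | cast j =>
          induction i using Fin.lastCases with
          | last => exact absurd hij (not_lt.2 (Fin.le_last _))
          | cast i => simpa using hg (by simpa using hij)
      · have := h.dsum_left hX
        simpa only [bigDsum, Fin.snoc_castSucc, Fin.snoc_last] using this

end MatTup

/-- If `X ≼ T 0 ⊕ ⋯ ⊕ T (n-1)` with all `T j` irreducible, then `X` is
unitarily equivalent to `⊕_{j ∈ J} T j` for some nonempty subset `J` of the indices,
taken in increasing order (here `J` is enumerated by the strictly monotone map `g`). -/
theorem stmt_7 {Λ : Type*} [Nonempty Λ] {n : ℕ} (hn : 0 < n)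
    (T : Fin n → MatTup Λ) (hT : ∀ j, (T j).Irred)
    (X : MatTup Λ) (h : X.Sub (MatTup.bigDsum T hn)) :
    ∃ (m : ℕ) (hm : 0 < m) (g : Fin m → Fin n), StrictMono g ∧
      X.UEquiv (MatTup.bigDsum (fun i => T (g i)) hm) := by
  obtain ⟨k, rfl⟩ : ∃ k, n = k + 1 := ⟨n - 1, by omega⟩
  obtain ⟨m, g, hg, hX⟩ := MatTup.main k T hT X h.emb
  exact ⟨m + 1, m.succ_pos, g, hg, hX⟩
end
end

section
/- Let K be a compact Hausdorff space, D a unital C*-algebra, and L a *-subalgebra of the C*-algebra C(K,D) of continuous D-valued functions on K (with the supremum norm) such that for any two points x, y ∈ K one of the following holds: (SW1) there exists u ∈ L such that u(x) and u(y) are normal elements of D with disjoint spectra; or (SW2) the spectra (computed in D) of f(x) and f(y) coincide for every selfadjoint f ∈ L. Then the uniform closure of L in C(K,D) equals Δ₂(L), the set of all u ∈ C(K,D) such that for any x, y ∈ K and every ε > 0 there exists v ∈ L with ‖v(x) − u(x)‖ < ε and ‖v(y) − u(y)‖ < ε. -/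
namespace SW13

open Topology Filter Set

set_option linter.unusedSectionVars false

variable {K : Type*} [TopologicalSpace K] [CompactSpace K] {D : Type*} [CStarAlgebra D]

lemma norm_eq_of_spec (L : NonUnitalStarSubalgebra ℂ C(K, D)) {x y : K}
    (h : ∀ f ∈ L, IsSelfAdjoint f → spectrum ℂ (f x) = spectrum ℂ (f y))
    {f : C(K, D)} (hf : f ∈ L) : ‖f x‖ = ‖f y‖ := by
  have key := h (star f * f) (mul_mem (star_mem hf) hf) (IsSelfAdjoint.star_mul_self f)
  have h1 : ∀ z, ‖f z‖ * ‖f z‖ = (spectralRadius ℂ ((star f * f) z)).toReal := by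
    intro z
    have : IsSelfAdjoint ((star f * f) z) := IsSelfAdjoint.star_mul_self (f z)
    rw [this.toReal_spectralRadius_complex_eq_norm]
    exact (CStarRing.norm_star_mul_self (x := f z)).symm
  have h2 : ‖f x‖ * ‖f x‖ = ‖f y‖ * ‖f y‖ := by
    rw [h1, h1]; simp only [spectralRadius, key]
  exact (mul_self_inj (norm_nonneg _) (norm_nonneg _)).1 h2

lemma norm_sub_eq_of_spec (L : NonUnitalStarSubalgebra ℂ C(K, D)) {x y : K}
    (h : ∀ f ∈ L, IsSelfAdjoint f → spectrum ℂ (f x) = spectrum ℂ (f y))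
    {f u : C(K, D)} (hf : f ∈ L)
    (hu : ∀ ε > 0, ∃ v ∈ L, ‖v x - u x‖ < ε ∧ ‖v y - u y‖ < ε) :
    ‖f x - u x‖ = ‖f y - u y‖ := by
  refine eq_of_abs_sub_le_all fun ε hε => ?_
  obtain ⟨v, hv, h1, h2⟩ := hu (ε / 2) (by positivity)
  have h3 : ‖f x - v x‖ = ‖f y - v y‖ := norm_eq_of_spec L h (f := f - v) (sub_mem hf hv)
  have h4 := abs_norm_sub_norm_le (f x - u x) (f x - v x)
  have h5 := abs_norm_sub_norm_le (f y - u y) (f y - v y)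
  rw [show f x - u x - (f x - v x) = v x - u x by abel] at h4
  rw [show f y - u y - (f y - v y) = v y - u y by abel] at h5
  rw [abs_le] at *
  constructor <;> linarith [h4.1, h4.2, h5.1, h5.2]

/-- the idealizer of a closed subalgebra -/
def idl (A : NonUnitalStarSubalgebra ℂ C(K, D)) : StarSubalgebra ℂ C(K, D) where
  carrier := {m | ∀ a ∈ A, m * a ∈ A ∧ a * m ∈ A}
  mul_mem' := by
    intro m n hm hn a ha
    refine ⟨?_, ?_⟩
    · rw [mul_assoc]; exact (hm _ (hn a ha).1).1
    · rw [← mul_assoc]; exact (hn _ (hm a ha).2).2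
  add_mem' := by
    intro m n hm hn a ha
    rw [add_mul, mul_add]
    exact ⟨add_mem (hm a ha).1 (hn a ha).1, add_mem (hm a ha).2 (hn a ha).2⟩
  algebraMap_mem' := by
    intro r a ha
    rw [Algebra.algebraMap_eq_smul_one]
    simp only [smul_mul_assoc, mul_smul_comm, one_mul, mul_one]
    exact ⟨SMulMemClass.smul_mem r ha, SMulMemClass.smul_mem r ha⟩
  star_mem' := by
    intro m hm a ha
    have := hm (star a) (star_mem ha)
    refine ⟨?_, ?_⟩
    · simpa using star_mem this.2
    · simpa using star_mem this.1

lemma idl_closed (A : NonUnitalStarSubalgebra ℂ C(K, D)) (hA : IsClosed (A : Set C(K, D))) :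
    IsClosed (idl A : Set C(K, D)) := by
  have : (idl A : Set C(K, D)) = ⋂ a ∈ A, ({m | m * a ∈ (A : Set C(K, D))} ∩
      {m | a * m ∈ (A : Set C(K, D))}) := by
    ext m
    simp only [mem_iInter, mem_inter_iff, mem_ofPred_eq, SetLike.mem_coe]
    rfl
  rw [this]
  refine isClosed_biInter fun a _ => IsClosed.inter ?_ ?_
  · exact hA.preimage (continuous_mul_const a)
  · exact hA.preimage (continuous_const_mul a)

lemma sep (M : StarSubalgebra ℂ C(K, D)) {F G : Set K} (hF : IsCompact F) (hG : IsCompact G)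
    (h : ∀ x ∈ F, ∀ y ∈ G, ∃ f ∈ M, (∀ᶠ z in 𝓝 x, f z = 1) ∧ ∀ᶠ z in 𝓝 y, f z = 0) :
    ∃ e ∈ M, (∀ z ∈ F, e z = 1) ∧ ∀ z ∈ G, e z = 0 := by
  have h1 : ∀ x ∈ F, ∃ f ∈ M, (∀ᶠ z in 𝓝 x, f z = 1) ∧ ∀ z ∈ G, f z = 0 := by
    intro x hx
    refine hG.induction_on (p := fun S => ∃ f ∈ M, (∀ᶠ z in 𝓝 x, f z = 1) ∧ ∀ z ∈ S, f z = 0)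
      ?_ ?_ ?_ ?_
    · exact ⟨1, one_mem M, by simp, by simp⟩
    · rintro s t hst ⟨f, hf, h1, h2⟩
      exact ⟨f, hf, h1, fun z hz => h2 z (hst hz)⟩
    · rintro s t ⟨f, hf, h1, h2⟩ ⟨g, hg, h3, h4⟩
      refine ⟨f * g, mul_mem hf hg, ?_, ?_⟩
      · filter_upwards [h1, h3] with z a b
        simp [a, b]
      · rintro z (hz | hz)
        · simp [h2 z hz]
        · simp [h4 z hz]
    · intro y hy
      obtain ⟨f, hf, h1, h2⟩ := h x hx y hy
      exact ⟨_, mem_nhdsWithin_of_mem_nhds h2, f, hf, h1, fun z hz => hz⟩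
  refine hF.induction_on (p := fun S => ∃ f ∈ M, (∀ z ∈ S, f z = 1) ∧ ∀ z ∈ G, f z = 0)
      ?_ ?_ ?_ ?_
  · exact ⟨0, zero_mem M, by simp, by simp⟩
  · rintro s t hst ⟨f, hf, h1, h2⟩
    exact ⟨f, hf, fun z hz => h1 z (hst hz), h2⟩
  · rintro s t ⟨f, hf, h1, h2⟩ ⟨g, hg, h3, h4⟩
    refine ⟨f + g - f * g, sub_mem (add_mem hf hg) (mul_mem hf hg), ?_, ?_⟩
    · rintro z (hz | hz)
      · simp [h1 z hz]
      · simp [h3 z hz]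
    · intro z hz
      simp [h2 z hz, h4 z hz]
  · intro y hy
    obtain ⟨f, hf, h1, h2⟩ := h1 y hy
    exact ⟨_, mem_nhdsWithin_of_mem_nhds h1, f, hf, fun z hz => hz, h2⟩

/-- evaluation -/
def ev (x : K) : C(K, D) →⋆ₐ[ℂ] D :=
  { toFun := fun f => f x
    map_one' := rfl
    map_mul' := fun _ _ => rfl
    map_zero' := rfl
    map_add' := fun _ _ => rfl
    commutes' := fun _ => rfl
    map_star' := fun _ => rfl }

lemma ev_cont (x : K) : Continuous (ev x : C(K, D) → D) := continuous_eval_const x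

lemma cfc_eval (f : ℂ → ℂ) (hf : Continuous f) (a : C(K, D)) (ha : IsStarNormal a) (x : K) :
    (cfc f a) x = cfc f (a x) := by
  have h2 : IsStarNormal (ev x a) := ha.map (ev x)
  exact (ev x).map_cfc f a hf.continuousOn (ev_cont x) ha h2

lemma cfc_mem' (M : StarSubalgebra ℂ C(K, D)) (hM : IsClosed (M : Set C(K, D)))
    (f : ℂ → ℂ) {a : C(K, D)} (ha : a ∈ M) : cfc f a ∈ M :=
  StarAlgebra.elemental.le_of_mem hM ha (cfc_mem_elemental f a)

lemma sep_bdd (M : StarSubalgebra ℂ C(K, D)) (hM : IsClosed (M : Set C(K, D)))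
    {F G : Set K} (hF : IsCompact F) (hG : IsCompact G)
    (h : ∀ x ∈ F, ∀ y ∈ G, ∃ f ∈ M, (∀ᶠ z in 𝓝 x, f z = 1) ∧ ∀ᶠ z in 𝓝 y, f z = 0) :
    ∃ e ∈ M, (∀ z ∈ F, e z = 1) ∧ (∀ z ∈ G, e z = 0) ∧ ∀ z, ‖e z‖ ≤ 1 := by
  obtain ⟨e, he, h1, h2⟩ := sep M hF hG h
  let φ : ℂ → ℂ := fun t => ((max 0 (min 1 t.re) : ℝ) : ℂ)
  have hφ : Continuous φ := by fun_prop
  have hn : IsStarNormal (star e * e) := (IsSelfAdjoint.star_mul_self e).isStarNormal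
  refine ⟨cfc φ (star e * e), cfc_mem' M hM φ (mul_mem (star_mem he) he), ?_, ?_, ?_⟩
  · intro z hz
    rw [cfc_eval φ hφ _ hn]
    simp [h1 z hz, φ]
  · intro z hz
    rw [cfc_eval φ hφ _ hn]
    simp [h2 z hz, φ]
  · intro z
    rw [cfc_eval φ hφ _ hn]
    refine norm_cfc_le zero_le_one fun t _ => ?_
    simp only [φ, Complex.norm_real, Real.norm_eq_abs]
    rw [abs_of_nonneg (le_max_left _ _)]
    simp

lemma spec_near {a : D} {c : ℂ} {t : ℂ} (ht : t ∈ spectrum ℂ a) {r : ℝ}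
    (h : ‖a - algebraMap ℂ D c‖ < r) : ‖t - c‖ < r := by
  have hn : Nontrivial D := by
    by_contra hh
    rw [not_nontrivial_iff_subsingleton] at hh
    simp [spectrum.of_subsingleton] at ht
  have : t - c ∈ spectrum ℂ (a - algebraMap ℂ D c) := by
    rw [spectrum.mem_iff] at *
    convert ht using 2
    simp
  exact (spectrum.norm_le_norm_of_mem this).trans_lt h

lemma sep_pts (M : StarSubalgebra ℂ C(K, D)) (hM : IsClosed (M : Set C(K, D))) {x y : K}
    (h : ∃ u ∈ M, IsStarNormal (u x) ∧ IsStarNormal (u y) ∧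
        spectrum ℂ (u x) ∩ spectrum ℂ (u y) = ∅) :
    ∃ f ∈ M, (∀ᶠ z in 𝓝 x, f z = 1) ∧ ∀ᶠ z in 𝓝 y, f z = 0 := by
  obtain ⟨u, hu, hx, hy, hd⟩ := h
  obtain ⟨g, hg0, hg1, -⟩ := exists_continuous_zero_one_of_isClosed
    (spectrum.isClosed (𝕜 := ℂ) (u y)) (spectrum.isClosed (𝕜 := ℂ) (u x))
    (disjoint_iff_inter_eq_empty.2 (by rwa [inter_comm]))
  let γ : ℂ → ℂ := fun t => (g t : ℂ)
  have hγ : Continuous γ := by fun_prop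
  let P : C(K, D) →⋆ₐ[ℂ] D × D := (ev x).prod (ev y)
  have hw : IsStarNormal ((u x, u y) : D × D) :=
    ⟨by rw [commute_iff_eq]; exact Prod.ext hx.1 hy.1⟩
  have h1 : cfc γ ((u x, u y) : D × D) = (1, 0) := by
    rw [cfc_map_prod (S := ℂ) γ (u x) (u y) hγ.continuousOn hw hx hy]
    congr 1
    · rw [cfc_congr (g := fun _ => 1), cfc_const_one ℂ (u x)]
      intro t ht; simp [γ, hg1 ht]
    · rw [cfc_congr (g := fun _ => 0), cfc_const_zero ℂ (u y)]
      intro t ht; simp [γ, hg0 ht]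
  have h2 : ((1, 0) : D × D) ∈ (M.map P).topologicalClosure := by
    rw [← h1]
    refine StarAlgebra.elemental.le_of_mem (StarSubalgebra.isClosed_topologicalClosure _) ?_
      (cfc_mem_elemental γ _)
    exact StarSubalgebra.le_topologicalClosure _ ⟨u, hu, rfl⟩
  have h3 : ((1, 0) : D × D) ∈ closure ((M.map P : StarSubalgebra ℂ (D × D)) : Set (D × D)) := h2
  obtain ⟨_, ⟨f0, hf0, rfl⟩, hdist⟩ := Metric.mem_closure_iff.1 h3 (1/4) (by norm_num)
  have h4 : dist (1 : D) (f0 x) < 1/4 := (le_max_left _ _).trans_lt hdist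
  have h5 : dist (0 : D) (f0 y) < 1/4 := (le_max_right _ _).trans_lt hdist
  rw [dist_comm, dist_eq_norm] at h4 h5
  let s : C(K, D) := (1/2 : ℂ) • (f0 + star f0)
  have hs : s ∈ M := M.smul_mem (add_mem hf0 (star_mem hf0)) _
  have hsn : IsStarNormal s := by
    refine IsSelfAdjoint.isStarNormal ?_
    simp only [s, IsSelfAdjoint, star_smul, star_add, star_star]
    rw [add_comm]; congr 1; simp
  have hsx : ∀ (z : K) (c : ℝ), ‖f0 z - algebraMap ℂ D c‖ < 1/4 →
      ‖s z - algebraMap ℂ D c‖ < 1/4 := by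
    intro z c hc
    have e1 : s z - algebraMap ℂ D c =
        (1/2 : ℂ) • ((f0 z - algebraMap ℂ D c) + star (f0 z - algebraMap ℂ D c)) := by
      have : star (algebraMap ℂ D c) = algebraMap ℂ D c := by
        rw [← algebraMap_star_comm]; simp
      rw [star_sub, this]
      simp only [s, ContinuousMap.smul_apply, ContinuousMap.add_apply, ContinuousMap.star_apply]
      module
    rw [e1, norm_smul]
    have := norm_add_le (f0 z - algebraMap ℂ D c) (star (f0 z - algebraMap ℂ D c))
    rw [norm_star] at this
    have h2 : ‖(1/2 : ℂ)‖ = 1/2 := by norm_num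
    rw [h2]
    linarith
  let φ : ℂ → ℂ := fun t => ((max 0 (min 1 (2 * t.re - 1/2)) : ℝ) : ℂ)
  have hφ : Continuous φ := by fun_prop
  have hcont : ∀ c : ℝ, Continuous fun z => ‖s z - algebraMap ℂ D c‖ := by
    intro c; fun_prop
  refine ⟨cfc φ s, cfc_mem' M hM φ hs, ?_, ?_⟩
  · have := hsx x 1 (by simpa using h4)
    filter_upwards [(hcont 1).continuousAt.eventually_lt_const this] with z hz
    rw [cfc_eval φ hφ _ hsn, cfc_congr (g := fun _ => 1), cfc_const_one ℂ (s z) (hsn.map (ev z))]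
    intro t ht
    have h6 := spec_near ht hz
    have h7 := (Complex.abs_re_le_norm _).trans_lt h6
    simp only [Complex.sub_re, Complex.ofReal_re, abs_lt] at h7
    have : min 1 (2 * t.re - 1/2) = 1 := min_eq_left (by linarith)
    simp only [φ, this, max_eq_right (zero_le_one' ℝ), Complex.ofReal_one]
  · have := hsx y 0 (by simpa using h5)
    filter_upwards [(hcont 0).continuousAt.eventually_lt_const this] with z hz
    rw [cfc_eval φ hφ _ hsn, cfc_congr (g := fun _ => 0), cfc_const_zero ℂ (s z)]
    intro t ht
    have h6 := spec_near ht hz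
    have h7 := (Complex.abs_re_le_norm _).trans_lt h6
    simp only [Complex.sub_re, Complex.ofReal_re, abs_lt] at h7
    have : max 0 (min 1 (2 * t.re - 1/2)) = 0 :=
      max_eq_left ((min_le_right _ _).trans (by linarith))
    simp only [φ, this, Complex.ofReal_zero]


/-- scalar functions as elements of `C(K, D)` -/
def sc (g : C(K, ℝ)) : C(K, D) := ⟨fun z => (g z : ℂ) • (1 : D), by fun_prop⟩

lemma clamp_sum (t : ℝ) (ht : 0 ≤ t) (n : ℕ) :
    ∑ k ∈ Finset.range n, max 0 (min 1 (t - k)) = min t n := by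
  induction n with
  | zero => simp [ht]
  | succ n ih =>
    rw [Finset.sum_range_succ, ih]
    push_cast
    rcases le_total t n with h | h
    · rw [min_eq_left h, min_eq_left (by linarith : t ≤ n + 1),
        max_eq_left ((min_le_right _ _).trans (by linarith))]; simp
    · rw [min_eq_right h]
      rcases le_total t (n + 1) with h' | h'
      · rw [min_eq_left h', min_eq_right (by linarith : t - n ≤ 1), max_eq_right (by linarith)]
        ring
      · rw [min_eq_right h', min_eq_left (by linarith : 1 ≤ t - n), max_eq_right zero_le_one]

lemma sc_mem [Nontrivial D] (M : StarSubalgebra ℂ C(K, D)) (hM : IsClosed (M : Set C(K, D)))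
    (g : C(K, ℝ)) (h0 : ∀ z, 0 ≤ g z) (h1 : ∀ z, g z ≤ 1)
    (hs : ∀ x y, g x ≠ g y → ∃ f ∈ M, (∀ᶠ z in 𝓝 x, f z = 1) ∧ ∀ᶠ z in 𝓝 y, f z = 0) :
    (sc g : C(K, D)) ∈ M := by
  suffices h : (sc g : C(K, D)) ∈ closure (M : Set C(K, D)) by rwa [hM.closure_eq] at h
  rw [Metric.mem_closure_iff]
  intro ε hε
  obtain ⟨n, hn⟩ := exists_nat_gt (2 / ε)
  have hn0 : (0 : ℝ) < n := lt_trans (by positivity) hn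
  have H : ∀ k : ℕ, ∃ e ∈ M, (∀ z ∈ {z | (k : ℝ) + 1 ≤ n * g z}, e z = 1) ∧
      (∀ z ∈ {z | n * g z ≤ k}, e z = 0) ∧ ∀ z, ‖e z‖ ≤ 1 := by
    intro k
    refine sep_bdd M hM (IsClosed.isCompact ?_) (IsClosed.isCompact ?_) ?_
    · exact isClosed_le (by fun_prop) (by fun_prop)
    · exact isClosed_le (by fun_prop) (by fun_prop)
    · intro x hx y hy
      refine hs x y fun hxy => ?_
      have hx' : (k : ℝ) + 1 ≤ n * g x := hx
      have hy' : n * g y ≤ k := hy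
      rw [hxy] at hx'
      linarith
  choose e he hF hG hb using H
  refine ⟨((1 / n : ℝ) : ℂ) • ∑ k ∈ Finset.range n, e k,
    M.smul_mem (sum_mem fun k _ => he k) _, ?_⟩
  rw [dist_eq_norm]
  refine lt_of_le_of_lt ?_ ((div_lt_comm₀ hε hn0).1 hn)
  rw [ContinuousMap.norm_le _ (by positivity)]
  intro z
  set t : ℝ := n * g z with ht
  have ht0 : 0 ≤ t := mul_nonneg hn0.le (h0 z)
  have htn : t ≤ n := by rw [ht]; nlinarith [h1 z]
  have hsum := clamp_sum t ht0 n
  rw [min_eq_left htn] at hsum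
  have e1 : (sc g - ((1 / n : ℝ) : ℂ) • ∑ k ∈ Finset.range n, e k : C(K, D)) z
      = ((1 / n : ℝ) : ℂ) • ∑ k ∈ Finset.range n,
        (((max 0 (min 1 (t - k)) : ℝ) : ℂ) • (1 : D) - e k z) := by
    rw [Finset.sum_sub_distrib, ← Finset.sum_smul, ← Complex.ofReal_sum, hsum, smul_sub, smul_smul,
      ← Complex.ofReal_mul]
    have : 1 / (n : ℝ) * t = g z := by rw [ht]; field_simp
    rw [this]
    simp [sc, ContinuousMap.sum_apply]
  rw [e1, norm_smul, Complex.norm_real, Real.norm_of_nonneg (by positivity), div_mul_eq_mul_div,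
    one_mul]
  gcongr
  refine (norm_sum_le _ _).trans ?_
  calc _ ≤ ∑ k ∈ Finset.range n, if k = ⌊t⌋₊ then (2 : ℝ) else 0 := by
        refine Finset.sum_le_sum fun k _ => ?_
        split_ifs with hk
        · refine (norm_sub_le _ _).trans ?_
          have : ‖((max 0 (min 1 (t - k)) : ℝ) : ℂ) • (1 : D)‖ ≤ 1 := by
            rw [norm_smul, CStarRing.norm_one, mul_one, Complex.norm_real,
              Real.norm_of_nonneg (le_max_left _ _)]
            simp
          linarith [hb k z]
        · rcases lt_or_gt_of_ne hk with h | h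
          · have h' : (k : ℝ) + 1 ≤ t := by
              have := (Nat.cast_le (α := ℝ)).2 (Nat.succ_le_of_lt h)
              push_cast at this
              exact this.trans (Nat.floor_le ht0)
            rw [hF k z h', min_eq_left (by linarith), max_eq_right zero_le_one]
            simp
          · have h' : t ≤ k := ((Nat.floor_lt ht0).1 h).le
            rw [hG k z h', max_eq_left ((min_le_right _ _).trans (by linarith))]
            simp
    _ ≤ 2 := by
        rw [Finset.sum_ite_eq']
        split_ifs <;> norm_num

theorem main (L : NonUnitalStarSubalgebra ℂ C(K, D))
    (hL : ∀ x y : K,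
      (∃ u ∈ L, IsStarNormal (u x) ∧ IsStarNormal (u y) ∧
        spectrum ℂ (u x) ∩ spectrum ℂ (u y) = ∅) ∨
      (∀ f ∈ L, IsSelfAdjoint f → spectrum ℂ (f x) = spectrum ℂ (f y))) :
    closure (L : Set C(K, D)) =
      {u : C(K, D) | ∀ x y : K, ∀ ε > 0, ∃ v ∈ L, ‖v x - u x‖ < ε ∧ ‖v y - u y‖ < ε} := by
  rcases subsingleton_or_nontrivial D with hD | hD
  · have : Subsingleton C(K, D) := ⟨fun f g => ContinuousMap.ext fun z => Subsingleton.elim _ _⟩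
    ext u
    constructor
    · intro _ x y ε hε
      exact ⟨0, zero_mem L, by simpa [Subsingleton.elim (_ : D) 0] using hε,
        by simpa [Subsingleton.elim (_ : D) 0] using hε⟩
    · intro _
      rw [Subsingleton.elim u 0]
      exact subset_closure (zero_mem L)
  apply Subset.antisymm
  · intro u hu x y ε hε
    obtain ⟨v, hv, hd⟩ := Metric.mem_closure_iff.1 hu ε hε
    rw [dist_comm, dist_eq_norm] at hd
    exact ⟨v, hv, ((v - u).norm_coe_le_norm x).trans_lt hd,
      ((v - u).norm_coe_le_norm y).trans_lt hd⟩
  intro u hu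
  have hu' : ∀ x y : K, ∀ ε > 0, ∃ v ∈ L, ‖v x - u x‖ < ε ∧ ‖v y - u y‖ < ε := hu
  let A := L.topologicalClosure
  have hA : IsClosed (A : Set C(K, D)) := L.isClosed_topologicalClosure
  have hLA : L ≤ A := L.le_topologicalClosure
  have hM := idl_closed A hA
  have hLM : ∀ f ∈ L, f ∈ idl A := fun f hf a ha => ⟨mul_mem (hLA hf) ha, mul_mem ha (hLA hf)⟩
  -- scalar functions constant on classes
  have key : ∀ g : C(K, ℝ), (∀ z, 0 ≤ g z) → (∀ z, g z ≤ 1) →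
      (∀ x y, (∀ f ∈ L, IsSelfAdjoint f → spectrum ℂ (f x) = spectrum ℂ (f y)) → g x = g y) →
      ∀ a ∈ L, (sc g : C(K, D)) * a ∈ A := by
    intro g h0 h1 hg a ha
    refine (sc_mem (idl A) hM g h0 h1 (fun x y hxy => ?_) a (hLA ha)).1
    rcases hL x y with ⟨v, hv, h⟩ | h
    · exact sep_pts (idl A) hM ⟨v, hLM v hv, h⟩
    · exact absurd (hg x y h) hxy
  have huA : u ∈ closure (A : Set C(K, D)) := by
    rw [Metric.mem_closure_iff]
    intro ε' hε'
    obtain ⟨ε, hε, hεε⟩ := exists_between hε'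
    have hv : ∀ x, ∃ v ∈ L, ‖v x - u x‖ < ε := fun x => by
      obtain ⟨v, hv, h, -⟩ := hu' x x ε hε
      exact ⟨v, hv, h⟩
    choose v hv hvx using hv
    let ρ : K → C(K, ℝ) := fun x => ⟨fun z => max 0 (ε - ‖v x z - u z‖), by fun_prop⟩
    have hρ0 : ∀ x z, 0 ≤ ρ x z := fun x z => le_max_left _ _
    have hρx : ∀ x, 0 < ρ x x := fun x => lt_max_of_lt_right (sub_pos.2 (hvx x))
    obtain ⟨t, -, ht⟩ := isCompact_univ.elim_nhds_subcover (fun x => {z | 0 < ρ x z})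
      (fun x _ => (isOpen_lt continuous_const (ρ x).continuous).mem_nhds (hρx x))
    have hS : ∀ z, 0 < ∑ x ∈ t, ρ x z := by
      intro z
      obtain ⟨x, hx, hz⟩ := mem_iUnion₂.1 (ht (mem_univ z))
      exact Finset.sum_pos' (fun i _ => hρ0 i z) ⟨x, hx, hz⟩
    let σ : K → C(K, ℝ) := fun x => ⟨fun z => ρ x z / ∑ y ∈ t, ρ y z,
      (ρ x).continuous.div (by fun_prop) fun z => (hS z).ne'⟩
    have hσ0 : ∀ x z, 0 ≤ σ x z := fun x z => div_nonneg (hρ0 x z) (hS z).le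
    have hσ1 : ∀ x ∈ t, ∀ z, σ x z ≤ 1 := fun x hx z =>
      (div_le_one (hS z)).2 (Finset.single_le_sum (f := fun y => ρ y z)
        (fun i _ => hρ0 i z) hx)
    have hσs : ∀ z, ∑ x ∈ t, σ x z = 1 := fun z => by
      change ∑ x ∈ t, ρ x z / ∑ y ∈ t, ρ y z = 1
      rw [← Finset.sum_div, div_self (hS z).ne']
    have hρc : ∀ w x y,
        (∀ f ∈ L, IsSelfAdjoint f → spectrum ℂ (f x) = spectrum ℂ (f y)) → ρ w x = ρ w y := by
      intro w x y h
      change max 0 (ε - ‖v w x - u x‖) = max 0 (ε - ‖v w y - u y‖)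
      rw [norm_sub_eq_of_spec L h (hv w) (hu' x y)]
    refine ⟨∑ x ∈ t, sc (σ x) * v x, sum_mem fun x hx => ?_, ?_⟩
    · refine key (σ x) (hσ0 x) (hσ1 x hx) (fun a b h => ?_) (v x) (hv x)
      change ρ x a / ∑ y ∈ t, ρ y a = ρ x b / ∑ y ∈ t, ρ y b
      rw [hρc x a b h, Finset.sum_congr rfl fun y _ => hρc y a b h]
    · rw [dist_comm, dist_eq_norm]
      refine lt_of_le_of_lt ?_ hεε
      rw [ContinuousMap.norm_le _ hε.le]
      intro z
      have e1 : (∑ x ∈ t, sc (σ x) * v x - u : C(K, D)) z =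
          ∑ x ∈ t, (σ x z : ℂ) • (v x z - u z) := by
        simp only [smul_sub, Finset.sum_sub_distrib, ← Finset.sum_smul]
        rw [← Complex.ofReal_sum, hσs]
        simp [sc, ContinuousMap.sum_apply]
      rw [e1]
      refine (norm_sum_le _ _).trans ?_
      calc _ ≤ ∑ x ∈ t, σ x z * ε := by
            refine Finset.sum_le_sum fun x _ => ?_
            rw [norm_smul, Complex.norm_real, Real.norm_of_nonneg (hσ0 x z)]
            rcases le_or_gt ‖v x z - u z‖ ε with h | h
            · exact mul_le_mul_of_nonneg_left h (hσ0 x z)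
            · have : ρ x z = 0 := max_eq_left (by linarith)
              have : σ x z = 0 := by
                change ρ x z / _ = 0
                rw [this, zero_div]
              simp [this]
        _ = ε := by rw [← Finset.sum_mul, hσs, one_mul]
  rw [hA.closure_eq] at huA
  exact huA

end SW13



/-- a Stone–Weierstrass type theorem. Let `K` be a compact Hausdorff
space, `D` a unital C*-algebra, and `L` a *-subalgebra of `C(K, D)` such that for all
`x y ∈ K` either (SW1) some `u ∈ L` has `u x`, `u y` normal with disjoint spectra, or
(SW2) `f x` and `f y` have the same spectrum for every selfadjoint `f ∈ L`. Then the
uniform closure of `L` equals `Δ₂(L)`, the set of `u ∈ C(K, D)` that can be uniformly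
approximated at every pair of points by elements of `L`. -/
theorem stmt_13 {K : Type*} [TopologicalSpace K] [CompactSpace K] [T2Space K]
    {D : Type*} [NormedRing D] [StarRing D] [CStarRing D] [NormedAlgebra ℂ D]
    [CompleteSpace D] [StarModule ℂ D]
    (L : NonUnitalStarSubalgebra ℂ C(K, D))
    (hL : ∀ x y : K,
      (∃ u ∈ L, IsStarNormal (u x) ∧ IsStarNormal (u y) ∧
        spectrum ℂ (u x) ∩ spectrum ℂ (u y) = ∅) ∨
      (∀ f ∈ L, IsSelfAdjoint f → spectrum ℂ (f x) = spectrum ℂ (f y))) :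
    closure (L : Set C(K, D)) =
      {u : C(K, D) | ∀ x y : K, ∀ ε > 0, ∃ v ∈ L, ‖v x - u x‖ < ε ∧ ‖v y - u y‖ < ε} := by
  letI : CStarAlgebra D := { }
  exact SW13.main (D := D) L hL
end

section
/- Let Ω be a locally compact Hausdorff space, 𝔅 a countable collection of pairwise disjoint Borel subsets of Ω covering Ω, A a C*-algebra, and V a *-subalgebra of C₀(Ω,A). Then the uniform closure of V in C₀(Ω,A) consists of exactly those f ∈ C₀(Ω,A) such that for every subset L ⊆ Ω satisfying (**) — namely, L ∩ B is compact for each B ∈ 𝔅 and L ∩ B is nonempty for only finitely many B ∈ 𝔅 — the restriction f|_L belongs to the uniform closure of V|_L := {g|_L : g ∈ V} inside C(L,A). -/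
open scoped ZeroAtInfty

namespace StmtAux
open scoped CompactlySupported NNReal ENNReal
open MeasureTheory

section
variable {Ω : Type*} [TopologicalSpace Ω] {E : Type*} [NormedAddCommGroup E]

lemma exists_c0_of_le (h : C₀(Ω, E)) (k : Ω → E) (hk : Continuous k) (hle : ∀ x, ‖k x‖ ≤ ‖h x‖) :
    ∃ k' : C₀(Ω, E), ∀ x, k' x = k x :=
  ⟨⟨⟨k, hk⟩, squeeze_zero_norm hle (by simpa using (zero_at_infty h).norm)⟩, fun _ => rfl⟩

lemma c0_norm_le {h : C₀(Ω, E)} {c : ℝ} (hc : 0 ≤ c) (hle : ∀ x, ‖h x‖ ≤ c) : ‖h‖ ≤ c := by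
  rw [← ZeroAtInftyContinuousMap.norm_toBCF_eq_norm]
  exact (BoundedContinuousFunction.norm_le hc).2 hle

lemma c0_apply_le (h : C₀(Ω, E)) (x : Ω) : ‖h x‖ ≤ ‖h‖ := by
  rw [← ZeroAtInftyContinuousMap.norm_toBCF_eq_norm]
  exact BoundedContinuousFunction.norm_coe_le_norm h.toBCF x

variable [NormedSpace ℝ E]

lemma riesz_decomp (h : C₀(Ω, E)) (u v : C_c(Ω, ℝ≥0)) (huv : ∀ x, ‖h x‖ ≤ u x + v x) :
    ∃ h₁ h₂ : C₀(Ω, E), (∀ x, ‖h₁ x‖ ≤ u x) ∧ (∀ x, ‖h₂ x‖ ≤ v x) ∧ h = h₁ + h₂ := by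
  let r : Ω → ℝ := fun x => (u x : ℝ) / (u x + v x)
  have hcu : Continuous fun x => (u x : ℝ) := NNReal.continuous_coe.comp u.continuous
  have hcv : Continuous fun x => (v x : ℝ) := NNReal.continuous_coe.comp v.continuous
  have hr0 : ∀ x, 0 ≤ r x := fun x => by positivity
  have hr1 : ∀ x, r x ≤ 1 := fun x => by
    apply div_le_one_of_le₀ _ (by positivity)
    have := (v x).coe_nonneg
    linarith
  have hle : ∀ x, ‖r x • h x‖ ≤ ‖h x‖ := fun x => by
    rw [norm_smul, Real.norm_of_nonneg (hr0 x)]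
    exact mul_le_of_le_one_left (norm_nonneg _) (hr1 x)
  have hcont : Continuous fun x => r x • h x := by
    rw [continuous_iff_continuousAt]
    intro x
    by_cases hx : (u x : ℝ) + v x = 0
    · have h0 : h x = 0 := by
        have := huv x
        rw [hx] at this
        simpa using this
      have hz : (fun x => r x • h x) x = 0 := by simp [h0]
      unfold ContinuousAt
      rw [hz]
      refine squeeze_zero_norm hle ?_
      have : ContinuousAt (fun y => ‖h y‖) x := (map_continuous h).norm.continuousAt
      simpa [ContinuousAt, h0] using this
    · exact (hcu.continuousAt.div (hcu.add hcv).continuousAt hx).smul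
        (map_continuous h).continuousAt
  obtain ⟨h₁, h1⟩ := exists_c0_of_le h _ hcont hle
  refine ⟨h₁, h - h₁, fun x => ?_, fun x => ?_, by abel⟩
  · rw [h1, norm_smul, Real.norm_of_nonneg (hr0 x)]
    refine (mul_le_mul_of_nonneg_left (huv x) (hr0 x)).trans ?_
    by_cases hx : (u x : ℝ) + v x = 0
    · simp [hx]
    · exact (div_mul_cancel₀ _ hx).le
  · have : (h - h₁) x = (1 - r x) • h x := by
      simp [h1, sub_smul]
    rw [this, norm_smul, Real.norm_of_nonneg (by linarith [hr1 x])]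
    refine (mul_le_mul_of_nonneg_left (huv x) (by linarith [hr1 x])).trans ?_
    by_cases hx : (u x : ℝ) + v x = 0
    · simp [hx]
    · have := div_mul_cancel₀ (u x : ℝ) hx
      simp only [r, sub_mul, this]
      linarith

/-- the set of values whose supremum is the total variation functional -/
def varSet (φ : C₀(Ω, E) →L[ℝ] ℝ) (u : C_c(Ω, ℝ≥0)) : Set ℝ :=
  {r | ∃ h : C₀(Ω, E), (∀ x, ‖h x‖ ≤ u x) ∧ φ h = r}

lemma varSet_le (φ : C₀(Ω, E) →L[ℝ] ℝ) (u : C_c(Ω, ℝ≥0)) {c : ℝ} (hc : 0 ≤ c)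
    (hu : ∀ x, (u x : ℝ) ≤ c) : ∀ r ∈ varSet φ u, r ≤ ‖φ‖ * c := by
  rintro r ⟨h, hh, rfl⟩
  refine (le_abs_self _).trans ((φ.le_opNorm h).trans ?_)
  exact mul_le_mul_of_nonneg_left (c0_norm_le hc fun x => (hh x).trans (hu x)) (norm_nonneg _)

lemma varSet_bdd (φ : C₀(Ω, E) →L[ℝ] ℝ) (u : C_c(Ω, ℝ≥0)) : BddAbove (varSet φ u) := by
  obtain ⟨C, hC⟩ := u.hasCompactSupport.isCompact.exists_bound_of_continuousOn
    (f := fun x => (u x : ℝ)) (NNReal.continuous_coe.comp u.continuous).continuousOn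
  refine ⟨‖φ‖ * max C 0, varSet_le φ u (le_max_right _ _) fun x => ?_⟩
  by_cases hx : x ∈ tsupport u
  · have := hC x hx
    rw [Real.norm_of_nonneg (by positivity)] at this
    exact this.trans (le_max_left _ _)
  · simp [image_eq_zero_of_notMem_tsupport hx]

lemma varSet_zero (φ : C₀(Ω, E) →L[ℝ] ℝ) (u : C_c(Ω, ℝ≥0)) : 0 ∈ varSet φ u :=
  ⟨0, by simp, by simp⟩

lemma var_nonneg (φ : C₀(Ω, E) →L[ℝ] ℝ) (u : C_c(Ω, ℝ≥0)) : 0 ≤ sSup (varSet φ u) :=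
  le_csSup (varSet_bdd φ u) (varSet_zero φ u)

lemma var_add (φ : C₀(Ω, E) →L[ℝ] ℝ) (u v : C_c(Ω, ℝ≥0)) :
    sSup (varSet φ (u + v)) = sSup (varSet φ u) + sSup (varSet φ v) := by
  apply le_antisymm
  · refine csSup_le ⟨0, varSet_zero φ _⟩ ?_
    rintro r ⟨h, hh, rfl⟩
    obtain ⟨h₁, h₂, H1, H2, rfl⟩ := riesz_decomp h u v (by simpa using hh)
    rw [map_add]
    exact add_le_add (le_csSup (varSet_bdd φ u) ⟨h₁, H1, rfl⟩)
      (le_csSup (varSet_bdd φ v) ⟨h₂, H2, rfl⟩)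
  · rw [← le_sub_iff_add_le]
    refine csSup_le ⟨0, varSet_zero φ _⟩ ?_
    rintro r ⟨h₁, H1, rfl⟩
    rw [le_sub_comm]
    refine csSup_le ⟨0, varSet_zero φ _⟩ ?_
    rintro r ⟨h₂, H2, rfl⟩
    rw [le_sub_iff_add_le', ← map_add]
    refine le_csSup (varSet_bdd φ _) ⟨h₁ + h₂, fun x => ?_, rfl⟩
    have := (norm_add_le (h₁ x) (h₂ x)).trans (add_le_add (H1 x) (H2 x))
    simpa using this

lemma var_smul_le (φ : C₀(Ω, E) →L[ℝ] ℝ) (c : ℝ≥0) (u : C_c(Ω, ℝ≥0)) :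
    c * sSup (varSet φ u) ≤ sSup (varSet φ (c • u)) := by
  rcases eq_or_ne c 0 with rfl | hc
  · simpa using var_nonneg φ _
  have hc' : (0 : ℝ) < c := by positivity
  rw [← le_div_iff₀' hc']
  refine csSup_le ⟨0, varSet_zero φ _⟩ ?_
  rintro r ⟨h, hh, rfl⟩
  rw [le_div_iff₀' hc']
  refine le_csSup (varSet_bdd φ _) ⟨(c : ℝ) • h, fun x => ?_, by simp⟩
  have := mul_le_mul_of_nonneg_left (hh x) hc'.le
  simpa [norm_smul] using this

lemma var_smul (φ : C₀(Ω, E) →L[ℝ] ℝ) (c : ℝ≥0) (u : C_c(Ω, ℝ≥0)) :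
    sSup (varSet φ (c • u)) = c * sSup (varSet φ u) := by
  apply le_antisymm _ (var_smul_le φ c u)
  rcases eq_or_ne c 0 with rfl | hc
  · have h := var_add φ 0 0
    rw [add_zero] at h
    simp only [zero_smul, NNReal.coe_zero, zero_mul]
    linarith
  have hc' : (0 : ℝ) < c := by positivity
  have := var_smul_le φ c⁻¹ (c • u)
  rw [inv_smul_smul₀ hc, NNReal.coe_inv, inv_mul_le_iff₀ hc'] at this
  exact this

/-- total variation functional -/
noncomputable def varFun (φ : C₀(Ω, E) →L[ℝ] ℝ) : C_c(Ω, ℝ≥0) →ₗ[ℝ≥0] ℝ≥0 where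
  toFun u := ⟨sSup (varSet φ u), var_nonneg φ u⟩
  map_add' u v := NNReal.eq (var_add φ u v)
  map_smul' c u := NNReal.eq (var_smul φ c u)

lemma exists_dominating_measure [LocallyCompactSpace Ω] [T2Space Ω]
    [MeasurableSpace Ω] [BorelSpace Ω] (φ : C₀(Ω, E) →L[ℝ] ℝ) :
    ∃ μ : Measure Ω, IsFiniteMeasure μ ∧ μ.Regular ∧
      ∀ h : C₀(Ω, E), HasCompactSupport h → ENNReal.ofReal (φ h) ≤ ∫⁻ x, ‖h x‖ₑ ∂μ := by
  refine ⟨NNRealRMK.rieszMeasure (varFun φ), ⟨?_⟩, inferInstance, fun h hh => ?_⟩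
  · refine lt_of_le_of_lt (b := ENNReal.ofReal ‖φ‖) ?_ ENNReal.ofReal_lt_top
    rw [isOpen_univ.measure_eq_iSup_isCompact]
    refine iSup_le fun K => iSup_le fun _ => iSup_le fun hK => ?_
    obtain ⟨f, hf1, -, hfc, hf⟩ := exists_continuous_one_zero_of_isCompact hK isClosed_empty
      (Set.disjoint_empty K)
    let u : C_c(Ω, ℝ≥0) := ⟨⟨fun x => (f x).toNNReal, by fun_prop⟩,
      hfc.comp_left (g := Real.toNNReal) (by simp)⟩
    have hu : ∀ x, u x = (f x).toNNReal := fun _ => rfl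
    calc NNRealRMK.rieszMeasure (varFun φ) K
        = ∫⁻ x in K, 1 ∂(NNRealRMK.rieszMeasure (varFun φ)) := by simp
      _ ≤ ∫⁻ x in K, u x ∂(NNRealRMK.rieszMeasure (varFun φ)) := by
          refine setLIntegral_mono' hK.measurableSet fun x hx => ?_
          simp [hu, hf1 hx]
      _ ≤ ∫⁻ x, u x ∂(NNRealRMK.rieszMeasure (varFun φ)) := setLIntegral_le_lintegral _ _
      _ = varFun φ u := NNRealRMK.lintegral_rieszMeasure _ _
      _ ≤ ENNReal.ofReal ‖φ‖ := by
          rw [ENNReal.ofReal, ENNReal.coe_le_coe, ← NNReal.coe_le_coe]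
          refine le_trans ?_ (Real.le_coe_toNNReal _)
          refine csSup_le ⟨0, varSet_zero φ u⟩ fun r hr => ?_
          have := varSet_le φ u zero_le_one (fun x => by simp [hu, (hf x).1, (hf x).2]) r hr
          simpa using this
  · let u : C_c(Ω, ℝ≥0) := ⟨⟨fun x => ‖h x‖₊, (map_continuous h).nnnorm⟩,
      hh.comp_left (g := fun y : E => ‖y‖₊) (by simp)⟩
    have : ∫⁻ x, ‖h x‖ₑ ∂(NNRealRMK.rieszMeasure (varFun φ)) = varFun φ u :=
      NNRealRMK.lintegral_rieszMeasure (varFun φ) u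
    rw [this, ENNReal.ofReal, ENNReal.coe_le_coe]
    refine Real.toNNReal_le_iff_le_coe.2 ?_
    exact le_csSup (varSet_bdd φ u) ⟨h, fun x => le_rfl, rfl⟩

/-- cutoff -/
lemma exists_compact_approx [LocallyCompactSpace Ω] [T2Space Ω] (h : C₀(Ω, E)) {δ : ℝ}
    (hδ : 0 < δ) : ∃ k : C₀(Ω, E), HasCompactSupport k ∧ (∀ x, ‖k x‖ ≤ ‖h x‖) ∧ ‖h - k‖ ≤ δ := by
  have h1 : ∀ᶠ x in Filter.cocompact Ω, ‖h x‖ < δ := by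
    have : Filter.Tendsto (fun x => ‖h x‖) (Filter.cocompact Ω) (nhds 0) := by
      simpa using (zero_at_infty h).norm
    exact this.eventually_lt_const hδ
  obtain ⟨K, hK, hKs⟩ := Filter.mem_cocompact.1 h1
  obtain ⟨f, hf1, -, hfc, hf⟩ := exists_continuous_one_zero_of_isCompact hK isClosed_empty
      (Set.disjoint_empty K)
  have hle : ∀ x, ‖f x • h x‖ ≤ ‖h x‖ := fun x => by
    rw [norm_smul, Real.norm_of_nonneg (hf x).1]
    exact mul_le_of_le_one_left (norm_nonneg _) (hf x).2
  obtain ⟨k, hk⟩ := exists_c0_of_le h (fun x => f x • h x) (by fun_prop) hle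
  have hk' : (k : Ω → E) = (f : Ω → ℝ) • (h : Ω → E) := funext hk
  refine ⟨k, ?_, fun x => by rw [hk]; exact hle x, c0_norm_le hδ.le fun x => ?_⟩
  · rw [hk']
    exact hfc.smul_right
  · by_cases hx : x ∈ K
    · simp [hk, hf1 hx, hδ.le]
    · have h2 : ‖h x‖ < δ := hKs hx
      have : (h - k) x = (1 - f x) • h x := by simp [hk, sub_smul]
      rw [this, norm_smul, Real.norm_of_nonneg (by linarith [(hf x).2])]
      nlinarith [(hf x).1, norm_nonneg (h x)]

end

/-- truncation -/
noncomputable def chi (M : ℝ) (t : ℝ) : ℝ := 1 - M / √(max |t| (M ^ 2))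

lemma chi_cont {M : ℝ} (hM : 0 < M) : Continuous (chi M) := by
  unfold chi
  refine continuous_const.sub (continuous_const.div (by fun_prop) fun t => ?_)
  have : 0 < max |t| (M ^ 2) := lt_max_of_lt_right (by positivity)
  positivity

lemma chi_zero {M : ℝ} (hM : 0 < M) {t : ℝ} (ht : |t| ≤ M ^ 2) : chi M t = 0 := by
  unfold chi
  rw [max_eq_right ht, Real.sqrt_sq hM.le, div_self hM.ne', sub_self]

lemma chi_bound {M : ℝ} (hM : 0 < M) (t : ℝ) : |t * (1 - chi M t) ^ 2| ≤ M ^ 2 := by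
  unfold chi
  have h : 0 < max |t| (M ^ 2) := lt_max_of_lt_right (by positivity)
  rw [sub_sub_cancel, div_pow, Real.sq_sqrt h.le, abs_mul, abs_of_pos (by positivity : 0 < M ^ 2 / _),
    mul_div_assoc', div_le_iff₀ h, mul_comm]
  exact mul_le_mul_of_nonneg_left (le_max_left _ _) (by positivity)

lemma trunc_exists {B A : Type*} [NonUnitalCStarAlgebra B] [NonUnitalCStarAlgebra A]
    (V : NonUnitalStarSubalgebra ℂ B) (g : B) (hg : g ∈ V) {M : ℝ} (hM : 0 < M) :
    ∃ g' ∈ closure (V : Set B), ‖g'‖ ≤ M ∧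
      ∀ π : B →⋆ₙₐ[ℂ] A, Continuous π → ‖π g‖ ≤ M → π g' = π g := by
  have hsa : IsSelfAdjoint (star g * g) := IsSelfAdjoint.star_mul_self g
  have hc := chi_cont hM
  have h0 : chi M 0 = 0 := chi_zero hM (by simp; positivity)
  set a := star g * g with ha
  set c := cfcₙ (chi M) a with hcdef
  have hcs : star c = c := (cfcₙ_predicate (chi M) a : IsSelfAdjoint c).star_eq
  have hcc : ContinuousOn (chi M) (quasispectrum ℝ a) := hc.continuousOn
  refine ⟨g - g * c, ?_, ?_, fun π hπ hπg => ?_⟩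
  · have hgW : g ∈ V.topologicalClosure := V.le_topologicalClosure hg
    have haW : a ∈ V.topologicalClosure := mul_mem (star_mem hgW) hgW
    have hcW : c ∈ V.topologicalClosure := by
      haveI : IsClosed (V.topologicalClosure : Set B) := V.isClosed_topologicalClosure
      exact cfcₙ_mem (𝕜' := ℂ) _ haW
    exact sub_mem hgW (mul_mem hgW hcW)
  · have key : star (g - g * c) * (g - g * c) = cfcₙ (fun t => t * (1 - chi M t) ^ 2) a := by
      have e1 : cfcₙ (fun t => t * (1 - chi M t) ^ 2) a
          = cfcₙ (fun t => (t - t * chi M t) - (chi M t * t - chi M t * (t * chi M t))) a := by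
        congr 1; ext t; ring
      have hid : cfcₙ (fun t : ℝ => t) a = a := cfcₙ_id' ℝ a
      have hm : cfcₙ (fun t => t * chi M t) a = a * c := by
        rw [cfcₙ_mul (fun t : ℝ => t) (chi M) a, hid]
      rw [e1, cfcₙ_sub _ _ a, cfcₙ_sub _ _ a, cfcₙ_sub _ _ a, hm, hid, 
        cfcₙ_mul (chi M) (fun t : ℝ => t) a, cfcₙ_mul (chi M) (fun t : ℝ => t * chi M t) a, hm, hid,
        ← hcdef, star_sub, star_mul, hcs, ha]
      noncomm_ring
    have h2 : ‖g - g * c‖ * ‖g - g * c‖ ≤ M ^ 2 := by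
      rw [← CStarRing.norm_star_mul_self, key]
      exact norm_cfcₙ_le fun t _ => chi_bound hM t
    exact abs_le_of_sq_le_sq' (by rw [sq]; exact h2) hM.le |>.2
  · have hpa : IsSelfAdjoint (π a) := hsa.map π
    have : π c = 0 := by
      rw [hcdef, NonUnitalStarAlgHom.map_cfcₙ (R := ℝ) π (chi M) a]
      rw [← cfcₙ_const_zero ℝ (π a)]
      refine cfcₙ_congr fun t ht => chi_zero hM ?_
      have := NonUnitalIsometricContinuousFunctionalCalculus.norm_quasispectrum_le (𝕜 := ℝ) (π a) ht hpa
      rw [Real.norm_eq_abs] at this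
      refine this.trans ?_
      rw [ha, map_mul, map_star, CStarRing.norm_star_mul_self, ← sq]
      gcongr
    rw [map_sub, map_mul, this, mul_zero, sub_zero]

lemma exists_large_L {Ω : Type*} [TopologicalSpace Ω] [T2Space Ω]
    [MeasurableSpace Ω] [BorelSpace Ω]
    (𝔅 : Set (Set Ω)) (h_count : 𝔅.Countable)
    (h_borel : ∀ B ∈ 𝔅, MeasurableSet B)
    (h_disj : 𝔅.Pairwise Disjoint)
    (h_cover : ⋃₀ 𝔅 = Set.univ) (μ : Measure Ω) [IsFiniteMeasure μ] [μ.Regular]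
    {ε : ℝ≥0∞} (hε : ε ≠ 0) :
    ∃ L : Set Ω, MeasurableSet L ∧ μ Lᶜ ≤ ε ∧
      (∀ B ∈ 𝔅, IsCompact (L ∩ B)) ∧ {B ∈ 𝔅 | (L ∩ B).Nonempty}.Finite := by
  classical
  haveI := h_count.to_subtype
  have hε2 : ε / 2 ≠ 0 := by simpa using hε
  obtain ⟨ε', hpos, hsum⟩ := ENNReal.exists_pos_sum_of_countable hε2 𝔅
  have hex : ∀ B : 𝔅, ∃ K ⊆ (B : Set Ω), IsCompact K ∧ μ (B \ K) < ε' B := fun B =>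
    (h_borel B B.2).exists_isCompact_sdiff_lt (measure_ne_top μ _) (by simpa using (hpos B).ne')
  choose K hKB hKc hKμ using hex
  have hdisj' : Pairwise (Function.onFun Disjoint fun B : 𝔅 => (B : Set Ω)) := fun B C hBC =>
    h_disj B.2 C.2 (fun h => hBC (Subtype.ext h))
  have hfin : ∑' B : 𝔅, μ (B : Set Ω) ≠ ∞ := by
    rw [← measure_iUnion hdisj' (fun B => h_borel B B.2)]
    exact measure_ne_top μ _
  obtain ⟨F, hF⟩ := ((ENNReal.tendsto_tsum_compl_atTop_zero hfin).eventually_lt_const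
    (pos_iff_ne_zero.2 hε2)).exists
  have hint : ∀ B : 𝔅, (⋃ C ∈ F, K C) ∩ B ⊆ if B ∈ F then K B else ∅ := by
    rintro B x ⟨hx, hxB⟩
    simp only [Set.mem_iUnion] at hx
    obtain ⟨C, hC, hxC⟩ := hx
    have : C = B := by
      by_contra hne
      exact Set.disjoint_left.1 (hdisj' hne) (hKB C hxC) hxB
    subst this
    simpa [hC] using hxC
  refine ⟨⋃ C ∈ F, K C, F.measurableSet_biUnion fun C _ => (hKc C).measurableSet, ?_, ?_, ?_⟩
  · have hsub : (⋃ C ∈ F, K C)ᶜ ⊆ (⋃ B : 𝔅, ((B : Set Ω) \ K B)) ∪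
        ⋃ B : {B : 𝔅 // B ∉ F}, ((B : 𝔅) : Set Ω) := by
      intro x hx
      have hxu : x ∈ ⋃₀ 𝔅 := by rw [h_cover]; trivial
      obtain ⟨B, hB, hxB⟩ := hxu
      by_cases hBF : (⟨B, hB⟩ : 𝔅) ∈ F
      · left
        refine Set.mem_iUnion.2 ⟨⟨B, hB⟩, hxB, fun hxK => hx ?_⟩
        exact Set.mem_biUnion hBF hxK
      · right
        exact Set.mem_iUnion.2 ⟨⟨⟨B, hB⟩, hBF⟩, hxB⟩
    calc μ (⋃ C ∈ F, K C)ᶜ ≤ _ := measure_mono hsub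
      _ ≤ _ := measure_union_le _ _
      _ ≤ ε / 2 + ε / 2 := by
        refine add_le_add ?_ ?_
        · refine (measure_iUnion_le _).trans (le_trans ?_ hsum.le)
          exact ENNReal.tsum_le_tsum fun B => (hKμ B).le
        · exact (measure_iUnion_le _).trans hF.le
      _ = ε := ENNReal.add_halves ε
  · intro B hB
    have h := hint ⟨B, hB⟩
    by_cases hBF : (⟨B, hB⟩ : 𝔅) ∈ F
    · have : (⋃ C ∈ F, K C) ∩ B = K ⟨B, hB⟩ := by
        refine Set.Subset.antisymm (by simpa [hBF] using h) fun x hx => ⟨?_, hKB _ hx⟩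
        exact Set.mem_biUnion hBF hx
      rw [this]
      exact hKc _
    · have : (⋃ C ∈ F, K C) ∩ B = ∅ := by
        refine Set.subset_empty_iff.1 ?_
        simpa only [hBF, if_false] using h
      rw [this]
      exact isCompact_empty
  · refine (F.finite_toSet.image Subtype.val).subset ?_
    rintro B ⟨hB, x, hx⟩
    refine ⟨⟨B, hB⟩, ?_, rfl⟩
    by_contra hBF
    have := hint ⟨B, hB⟩ hx
    have hBF' : (⟨B, hB⟩ : 𝔅) ∉ F := hBF
    simp only [hBF', if_false] at this
    exact this

/-- point evaluation -/
def evHom {Ω : Type*} [TopologicalSpace Ω] {A : Type*} [NonUnitalCStarAlgebra A] (x : Ω) :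
    C₀(Ω, A) →⋆ₙₐ[ℂ] A where
  toFun f := f x
  map_smul' _ _ := rfl
  map_zero' := rfl
  map_add' _ _ := rfl
  map_mul' _ _ := rfl
  map_star' _ := rfl

lemma evHom_cont {Ω : Type*} [TopologicalSpace Ω] {A : Type*} [NonUnitalCStarAlgebra A] (x : Ω) :
    Continuous (evHom (A := A) x) := by
  refine (LipschitzWith.of_dist_le_mul (K := 1) fun f g => ?_).continuous
  rw [dist_eq_norm, dist_eq_norm, ← map_sub, NNReal.coe_one, one_mul]
  exact c0_apply_le (f - g) x

lemma hard_dir {Ω : Type*} [TopologicalSpace Ω] [LocallyCompactSpace Ω] [T2Space Ω]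
    [MeasurableSpace Ω] [BorelSpace Ω]
    {A : Type*} [NonUnitalCStarAlgebra A]
    (𝔅 : Set (Set Ω)) (h_count : 𝔅.Countable)
    (h_borel : ∀ B ∈ 𝔅, MeasurableSet B)
    (h_disj : 𝔅.Pairwise Disjoint)
    (h_cover : ⋃₀ 𝔅 = Set.univ)
    (V : NonUnitalStarSubalgebra ℂ C₀(Ω, A)) (f : C₀(Ω, A))
    (hf : ∀ L : Set Ω,
        ((∀ B ∈ 𝔅, IsCompact (L ∩ B)) ∧ {B ∈ 𝔅 | (L ∩ B).Nonempty}.Finite) →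
        ∀ ε > 0, ∃ g ∈ V, ∀ x ∈ L, ‖f x - g x‖ < ε) :
    f ∈ closure (V : Set C₀(Ω, A)) := by
  by_contra hfV
  have hsm : ∀ a ∈ closure (V : Set C₀(Ω, A)), ∀ t : ℝ, t • a ∈ closure (V : Set C₀(Ω, A)) := by
    intro a ha t
    have : ((t : ℂ) • a) ∈ V.topologicalClosure := SMulMemClass.smul_mem (t : ℂ) ha
    exact this
  have hconv : Convex ℝ (closure (V : Set C₀(Ω, A))) := by
    intro a ha b hb s t _ _ _
    have : s • a + t • b ∈ V.topologicalClosure :=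
      add_mem (show s • a ∈ V.topologicalClosure from hsm a ha s)
        (show t • b ∈ V.topologicalClosure from hsm b hb t)
    exact this
  obtain ⟨φ, u, hφ, hu⟩ := geometric_hahn_banach_closed_point hconv isClosed_closure hfV
  have h0 : ∀ a ∈ closure (V : Set C₀(Ω, A)), φ a = 0 := by
    intro a ha
    by_contra hne
    have := hφ _ (hsm a ha ((u + 1) / φ a))
    rw [map_smul, smul_eq_mul, div_mul_cancel₀ _ hne] at this
    linarith
  have hu0 : 0 < u := by
    have := hφ 0 (subset_closure (zero_mem V))
    simpa using this
  have hc : 0 < φ f := hu0.trans hu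
  obtain ⟨μ, hμ1, hμ2, hμ⟩ := exists_dominating_measure φ
  set N : ℝ := ‖f‖ + (‖f‖ + 1) with hN
  have hNpos : 0 < N := by positivity
  have hD : 0 < μ.real Set.univ + N + ‖φ‖ := by positivity
  obtain ⟨ε, hε, hε1, hεc⟩ : ∃ ε : ℝ, 0 < ε ∧ ε ≤ 1 ∧
      ε * (μ.real Set.univ + N + ‖φ‖) < φ f := by
    refine ⟨min 1 (φ f / (2 * (μ.real Set.univ + N + ‖φ‖))), by positivity, min_le_left _ _, ?_⟩
    refine lt_of_le_of_lt (mul_le_mul_of_nonneg_right (min_le_right _ _) hD.le) ?_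
    rw [div_mul_eq_mul_div, div_lt_iff₀ (by positivity)]
    nlinarith [mul_pos hc hD]
  obtain ⟨L, hLm, hLμ, hL⟩ := exists_large_L 𝔅 h_count h_borel h_disj h_cover μ
    (ε := ENNReal.ofReal ε) (by simpa using hε)
  obtain ⟨g, hgV, hg⟩ := hf L hL ε hε
  have hMpos : 0 < ‖f‖ + 1 := by positivity
  obtain ⟨g', hg'V, hg'n, hg'⟩ := trunc_exists (A := A) V g hgV hMpos
  have hg'L : ∀ x ∈ L, g' x = g x := by
    intro x hx
    refine hg' (evHom x) (evHom_cont x) ?_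
    have h1 : ‖g x‖ ≤ ‖f x‖ + ‖f x - g x‖ := by
      have := norm_sub_le (f x) (f x - g x)
      simpa using this
    have h2 := hg x hx
    have h3 := c0_apply_le f x
    change ‖g x‖ ≤ _
    linarith
  obtain ⟨k, hkc, hkle, hkd⟩ := exists_compact_approx (f - g') hε
  have hkN : ∀ x, ‖k x‖ ≤ N := fun x => by
    have h1 := hkle x
    have h2 := c0_apply_le (f - g') x
    have h3 := norm_sub_le f g'
    linarith
  have hkL : ∀ x ∈ L, ‖k x‖ ≤ ε := fun x hx => by
    refine (hkle x).trans ?_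
    have : (f - g') x = f x - g x := by
      rw [ZeroAtInftyContinuousMap.sub_apply, hg'L x hx]
    rw [this]
    exact (hg x hx).le
  have hint : ENNReal.ofReal (φ k) ≤ ENNReal.ofReal (ε * μ.real Set.univ + N * ε) := by
    calc ENNReal.ofReal (φ k) ≤ ∫⁻ x, ‖k x‖ₑ ∂μ := hμ k hkc
      _ = ∫⁻ x in L, ‖k x‖ₑ ∂μ + ∫⁻ x in Lᶜ, ‖k x‖ₑ ∂μ := (lintegral_add_compl _ hLm).symm
      _ ≤ ∫⁻ x in L, ENNReal.ofReal ε ∂μ + ∫⁻ x in Lᶜ, ENNReal.ofReal N ∂μ := by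
        refine add_le_add (setLIntegral_mono' hLm fun x hx => ?_)
          (lintegral_mono fun x => ?_)
        · rw [← ofReal_norm]
          exact ENNReal.ofReal_le_ofReal (hkL x hx)
        · rw [← ofReal_norm]
          exact ENNReal.ofReal_le_ofReal (hkN x)
      _ = ENNReal.ofReal ε * μ L + ENNReal.ofReal N * μ Lᶜ := by
        rw [setLIntegral_const, setLIntegral_const]
      _ ≤ ENNReal.ofReal ε * μ Set.univ + ENNReal.ofReal N * ENNReal.ofReal ε := by
        gcongr
        exact Set.subset_univ L
      _ = ENNReal.ofReal (ε * μ.real Set.univ + N * ε) := by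
        rw [ENNReal.ofReal_add (p := ε * μ.real Set.univ) (by positivity) (by positivity), ENNReal.ofReal_mul hε.le,
          ENNReal.ofReal_mul hNpos.le, ofReal_measureReal]
  have hφk := (ENNReal.ofReal_le_ofReal_iff (by positivity)).1 hint
  have hφd : φ (f - g' - k) ≤ ‖φ‖ * ε :=
    (le_abs_self _).trans ((φ.le_opNorm _).trans (mul_le_mul_of_nonneg_left hkd (norm_nonneg _)))
  rw [map_sub, map_sub, h0 g' hg'V] at hφd
  nlinarith

end StmtAux

open StmtAux

/-- Let `Ω` be locally compact Hausdorff, `𝔅` a countable collection of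
pairwise disjoint Borel subsets of `Ω` covering `Ω`, `A` a C*-algebra and `V` a
*-subalgebra of `C₀(Ω, A)`. Then the uniform closure of `V` consists of exactly those
`f ∈ C₀(Ω, A)` such that for every `L ⊆ Ω` satisfying (**) — `L ∩ B` is compact for each
`B ∈ 𝔅` and nonempty for only finitely many `B ∈ 𝔅` — the restriction `f|_L` lies in the
uniform closure of `V|_L` (expressed here by uniform approximation on `L`). -/
theorem stmt_14 {Ω : Type*} [TopologicalSpace Ω] [LocallyCompactSpace Ω] [T2Space Ω]
    [MeasurableSpace Ω] [BorelSpace Ω]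
    {A : Type*} [NonUnitalNormedRing A] [StarRing A] [CStarRing A]
    [NormedSpace ℂ A] [IsScalarTower ℂ A A] [SMulCommClass ℂ A A] [StarModule ℂ A]
    [CompleteSpace A]
    (𝔅 : Set (Set Ω)) (h_count : 𝔅.Countable)
    (h_borel : ∀ B ∈ 𝔅, MeasurableSet B)
    (h_disj : 𝔅.Pairwise Disjoint)
    (h_cover : ⋃₀ 𝔅 = Set.univ)
    (V : NonUnitalStarSubalgebra ℂ C₀(Ω, A)) :
    closure (V : Set C₀(Ω, A)) =
      {f : C₀(Ω, A) | ∀ L : Set Ω,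
        ((∀ B ∈ 𝔅, IsCompact (L ∩ B)) ∧ {B ∈ 𝔅 | (L ∩ B).Nonempty}.Finite) →
        ∀ ε > 0, ∃ g ∈ V, ∀ x ∈ L, ‖f x - g x‖ < ε} := by
  letI : NonUnitalCStarAlgebra A := {}
  ext f
  constructor
  · intro hf L _ ε hε
    obtain ⟨g, hg, hd⟩ := Metric.mem_closure_iff.1 hf ε hε
    refine ⟨g, hg, fun x _ => ?_⟩
    rw [dist_eq_norm] at hd
    exact lt_of_le_of_lt (c0_apply_le (f - g) x) hd
  · intro hf
    exact hard_dir 𝔅 h_count h_borel h_disj h_cover V f hf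
end

section
/- (Equivariant Michael selection theorem.) Let X be a paracompact Hausdorff topological space equipped with a continuous action U_N × X → X, (U,x) ↦ U.x, of the unitary group U_N of complex N×N matrices (so (UV).x = U.(V.x), I.x = x, and the action map is continuous). Let F be a multifunction assigning to each x ∈ X a nonempty closed convex subset F(x) of M_N(ℂ), which is lower semicontinuous (for every open U ⊆ M_N(ℂ), the set {x ∈ X : F(x) ∩ U ≠ ∅} is open) and satisfies F(U.x) = U F(x) U⁻¹ := {U A U⁻¹ : A ∈ F(x)} for all x ∈ X and U ∈ U_N. Then there exists a continuous map f : X → M_N(ℂ) with f(x) ∈ F(x) for every x ∈ X and f(U.x) = U f(x) U⁻¹ for all x ∈ X and U ∈ U_N. -/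
open Set Filter Topology MeasureTheory

lemma michael_approx {X E : Type*} [TopologicalSpace X] [ParacompactSpace X] [T2Space X]
    [NormedAddCommGroup E] [NormedSpace ℝ E] (F : X → Set E)
    (h_ne : ∀ x, (F x).Nonempty) (h_convex : ∀ x, Convex ℝ (F x))
    (h_lsc : ∀ V : Set E, IsOpen V → IsOpen {x | (F x ∩ V).Nonempty})
    (ε : ℝ) (hε : 0 < ε) :
    ∃ g : C(X, E), ∀ x, (F x ∩ Metric.ball (g x) ε).Nonempty := by
  obtain ⟨g, hg⟩ := exists_continuous_forall_mem_convex_of_local_const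
    (t := fun x => Metric.thickening ε (F x)) (fun x => (h_convex x).thickening ε) (by
      intro x
      obtain ⟨c, hc⟩ := h_ne x
      refine ⟨c, ?_⟩
      filter_upwards [(h_lsc (Metric.ball c ε) Metric.isOpen_ball).mem_nhds
        ⟨c, hc, Metric.mem_ball_self hε⟩] with y hy
      obtain ⟨z, hz, hzc⟩ := hy
      exact Metric.mem_thickening_iff.2 ⟨z, hz, by rw [dist_comm]; exact hzc⟩)
  refine ⟨g, fun x => ?_⟩
  obtain ⟨z, hz, hd⟩ := Metric.mem_thickening_iff.1 (hg x)
  exact ⟨z, hz, by rw [Metric.mem_ball, dist_comm]; exact hd⟩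

lemma michael_step {X E : Type*} [TopologicalSpace X] [ParacompactSpace X] [T2Space X]
    [NormedAddCommGroup E] [NormedSpace ℝ E] (F : X → Set E)
    (h_convex : ∀ x, Convex ℝ (F x))
    (h_lsc : ∀ V : Set E, IsOpen V → IsOpen {x | (F x ∩ V).Nonempty})
    (ε ε' : ℝ) (hε' : 0 < ε') (f : C(X, E))
    (hf : ∀ x, (F x ∩ Metric.ball (f x) ε).Nonempty) :
    ∃ g : C(X, E), (∀ x, (F x ∩ Metric.ball (g x) ε').Nonempty) ∧
      ∀ x, dist (f x) (g x) ≤ ε + ε' := by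
  obtain ⟨g, hg⟩ := michael_approx (fun x => F x ∩ Metric.ball (f x) ε) hf
    (fun x => (h_convex x).inter (convex_ball _ _)) (by
      intro V hV
      rw [isOpen_iff_mem_nhds]
      rintro x ⟨c, ⟨hc, hcb⟩, hcV⟩
      rw [Metric.mem_ball] at hcb
      obtain ⟨r, hr1, hr2⟩ := exists_between hcb
      have h1 := (h_lsc (V ∩ Metric.ball c (ε - r)) (hV.inter Metric.isOpen_ball)).mem_nhds
        (show x ∈ _ from ⟨c, hc, hcV, Metric.mem_ball_self (by linarith)⟩)
      have h2 : ∀ᶠ y in 𝓝 x, dist c (f y) < r :=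
        (Continuous.tendsto (by fun_prop : Continuous fun y => dist c (f y)) x).eventually_lt_const
          hr1
      filter_upwards [h1, h2] with y hy1 hy2
      obtain ⟨z, hz, hzV, hzb⟩ := hy1
      refine ⟨z, ⟨hz, ?_⟩, hzV⟩
      rw [Metric.mem_ball] at hzb ⊢
      linarith [dist_triangle z c (f y)]) ε' hε'
  refine ⟨g, fun x => ?_, fun x => ?_⟩
  · obtain ⟨z, ⟨hz, -⟩, hb⟩ := hg x
    exact ⟨z, hz, hb⟩
  · obtain ⟨z, ⟨-, hz⟩, hb⟩ := hg x
    rw [Metric.mem_ball] at hz hb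
    linarith [dist_triangle_left (f x) (g x) z]

lemma michael_selection {X E : Type*} [TopologicalSpace X] [ParacompactSpace X] [T2Space X]
    [NormedAddCommGroup E] [NormedSpace ℝ E] [CompleteSpace E] (F : X → Set E)
    (h_ne : ∀ x, (F x).Nonempty) (h_closed : ∀ x, IsClosed (F x))
    (h_convex : ∀ x, Convex ℝ (F x))
    (h_lsc : ∀ V : Set E, IsOpen V → IsOpen {x | (F x ∩ V).Nonempty}) :
    ∃ g : X → E, Continuous g ∧ ∀ x, g x ∈ F x := by
  have hpos : ∀ n : ℕ, (0 : ℝ) < 1 / 2 ^ n := fun n => by positivity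
  obtain ⟨f0, hf0⟩ := michael_approx F h_ne h_convex h_lsc (1 / 2 ^ 0) (hpos 0)
  choose! S hS1 hS2 using fun (n : ℕ) (f : C(X, E)) =>
    michael_step F h_convex h_lsc (1 / 2 ^ n) (1 / 2 ^ (n + 1)) (hpos _) f
  let f : ℕ → C(X, E) := fun n => Nat.rec f0 (fun n g => S n g) n
  have hf : ∀ n x, (F x ∩ Metric.ball (f n x) (1 / 2 ^ n)).Nonempty := by
    intro n
    induction n with
    | zero => exact hf0
    | succ n ih => exact hS1 n (f n) ih
  have hd : ∀ x n, dist (f n x) (f (n + 1) x) ≤ 4 / 2 / 2 ^ n := by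
    intro x n
    refine (hS2 n (f n) (hf n) x).trans ?_
    have h := hpos n
    rw [pow_succ, ← div_div, show (4 : ℝ) / 2 / 2 ^ n = 2 * (1 / 2 ^ n) by ring]
    linarith
  choose g hg using fun x => cauchySeq_tendsto_of_complete (cauchySeq_of_le_geometric_two (hd x))
  have hb : ∀ x n, dist (f n x) (g x) ≤ 4 / 2 ^ n := fun x n =>
    dist_le_of_le_geometric_two_of_tendsto (hd x) (hg x) n
  have hlim : ∀ c : ℝ, Tendsto (fun n : ℕ => c / 2 ^ n) atTop (𝓝 0) := fun c =>
    tendsto_const_nhds.div_atTop (tendsto_pow_atTop_atTop_of_one_lt (by norm_num))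
  refine ⟨g, ?_, fun x => ?_⟩
  · refine TendstoUniformly.continuous (F := fun n x => f n x) (p := atTop) ?_
      (Frequently.of_forall fun n => (f n).continuous)
    rw [Metric.tendstoUniformly_iff]
    intro ε hε
    filter_upwards [(hlim 4).eventually_lt_const hε] with n hn x
    rw [dist_comm]
    exact (hb x n).trans_lt hn
  · choose z hz hzb using fun n => hf n x
    refine (h_closed x).mem_of_tendsto (f := z) (b := atTop) ?_ (Eventually.of_forall hz)
    rw [tendsto_iff_dist_tendsto_zero]
    refine squeeze_zero (fun _ => dist_nonneg) (fun n => ?_) (hlim 5)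
    have h1 := hzb n
    rw [Metric.mem_ball] at h1
    have h2 := hb x n
    rw [show (5 : ℝ) / 2 ^ n = 1 / 2 ^ n + 4 / 2 ^ n by ring]
    linarith [dist_triangle (z n) (f n x) (g x)]

lemma continuous_average {X G E : Type*} [TopologicalSpace X] [TopologicalSpace G]
    [CompactSpace G] [MeasurableSpace G] [BorelSpace G] [NormedAddCommGroup E] [NormedSpace ℝ E]
    (μ : Measure G) [IsProbabilityMeasure μ] (hint : ∀ φ : C(G, E), Integrable φ μ)
    (h : X × G → E) (hh : Continuous h) : Continuous fun x => ∫ u, h (x, u) ∂μ := by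
  have h1 : Continuous fun φ : C(G, E) => ∫ u, φ u ∂μ := by
    refine LipschitzWith.continuous (K := 1) (LipschitzWith.of_dist_le_mul fun φ ψ => ?_)
    rw [dist_eq_norm, ← integral_sub (hint φ) (hint ψ)]
    have := norm_integral_le_of_norm_le_const (μ := μ) (f := fun u => φ u - ψ u) (C := dist φ ψ)
      (Eventually.of_forall fun u => by
        rw [← dist_eq_norm]; exact ContinuousMap.dist_apply_le_dist u)
    simpa using this
  exact h1.comp (ContinuousMap.curry ⟨h, hh⟩).continuous

lemma equivariant_michael {X G E : Type*} [TopologicalSpace X] [ParacompactSpace X] [T2Space X]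
    [Group G] [TopologicalSpace G] [IsTopologicalGroup G] [CompactSpace G]
    [NormedAddCommGroup E] [NormedSpace ℝ E] [CompleteSpace E]
    [SecondCountableTopology E]
    (act : G → X → X) (h_one : ∀ x, act 1 x = x)
    (h_mul : ∀ U V x, act (U * V) x = act U (act V x))
    (h_cont : Continuous fun p : G × X => act p.1 p.2)
    (ρ : G → E →ₗ[ℝ] E) (ρ_mul : ∀ U V e, ρ (U * V) e = ρ U (ρ V e))
    (ρ_cont : Continuous fun p : G × E => ρ p.1 p.2)
    (F : X → Set E)
    (h_ne : ∀ x, (F x).Nonempty) (h_closed : ∀ x, IsClosed (F x))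
    (h_convex : ∀ x, Convex ℝ (F x))
    (h_lsc : ∀ V : Set E, IsOpen V → IsOpen {x | (F x ∩ V).Nonempty})
    (h_equiv : ∀ U x, F (act U x) = (fun A => ρ U A) '' F x) :
    ∃ f : X → E, Continuous f ∧ (∀ x, f x ∈ F x) ∧ ∀ U x, f (act U x) = ρ U (f x) := by
  obtain ⟨g, hgc, hg⟩ := michael_selection F h_ne h_closed h_convex h_lsc
  let _ : MeasurableSpace G := borel _
  have : BorelSpace G := ⟨rfl⟩
  let μ : Measure G := Measure.haarMeasure ⊤
  have : IsProbabilityMeasure μ := ⟨Measure.haarMeasure_self⟩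
  have hint : ∀ φ : G → E, Continuous φ → Integrable φ μ := fun φ hφ =>
    hφ.integrable_of_hasCompactSupport (HasCompactSupport.of_compactSpace φ)
  let h : X × G → E := fun p => ρ p.2 (g (act p.2⁻¹ p.1))
  have hh : Continuous h := by
    have h1 : Continuous fun p : X × G => g (act p.2⁻¹ p.1) :=
      hgc.comp (h_cont.comp (continuous_snd.inv.prodMk continuous_fst))
    exact ρ_cont.comp (continuous_snd.prodMk h1)
  have hx : ∀ x, Integrable (fun u => h (x, u)) μ := fun x =>
    hint _ (hh.comp (Continuous.prodMk_right x))
  refine ⟨fun x => ∫ u, h (x, u) ∂μ, ?_, fun x => ?_, fun V x => ?_⟩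
  · exact continuous_average μ (fun φ => hint φ φ.continuous) h hh
  · refine (h_convex x).integral_mem (h_closed x) (Eventually.of_forall fun u => ?_) (hx x)
    have h1 := h_equiv u (act u⁻¹ x)
    rw [← h_mul, mul_inv_cancel, h_one] at h1
    rw [h1]
    exact ⟨_, hg _, rfl⟩
  · let L : E →L[ℝ] E := ⟨ρ V, ρ_cont.comp (Continuous.prodMk_right V)⟩
    have h2 := L.integral_comp_comm (hx x)
    refine Eq.trans ?_ h2
    beta_reduce
    rw [← integral_mul_left_eq_self (μ := μ) (fun u => h (act V x, u)) V]
    refine integral_congr_ae (Eventually.of_forall fun u => ?_)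
    change ρ (V * u) (g (act (V * u)⁻¹ (act V x))) = ρ V (ρ u (g (act u⁻¹ x)))
    rw [← h_mul, mul_inv_rev, inv_mul_cancel_right, ρ_mul]

lemma isClosed_unitaryGroup (N : ℕ) :
    IsClosed (Matrix.unitaryGroup (Fin N) ℂ : Set (Matrix (Fin N) (Fin N) ℂ)) :=
  isClosed_unitary

attribute [local instance] Matrix.normedAddCommGroup Matrix.normedSpace

lemma compactSpace_unitaryGroup (N : ℕ) : CompactSpace (Matrix.unitaryGroup (Fin N) ℂ) := by
  refine isCompact_iff_compactSpace.1 (?_ : IsCompact (Matrix.unitaryGroup (Fin N) ℂ : Set (Matrix (Fin N) (Fin N) ℂ)))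
  refine Metric.isCompact_of_isClosed_isBounded (isClosed_unitaryGroup N) ?_
  refine isBounded_iff_forall_norm_le.2 ⟨1, fun U hU => ?_⟩
  exact entrywise_sup_norm_bound_of_unitary hU


/-- equivariant Michael selection theorem. Let `X` be a paracompact
Hausdorff space with a continuous action of the unitary group `U_N` of `M_N(ℂ)`, and let
`F` be a lower semicontinuous multifunction on `X` with nonempty closed convex values in
`M_N(ℂ)` satisfying `F(U.x) = U F(x) U⁻¹`. Then `F` admits a continuous selection `f`
with `f(U.x) = U f(x) U⁻¹`. -/
theorem stmt_15 {X : Type*} [TopologicalSpace X] [ParacompactSpace X] [T2Space X]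
    {N : ℕ} (act : Matrix.unitaryGroup (Fin N) ℂ → X → X)
    (h_one : ∀ x, act 1 x = x)
    (h_mul : ∀ U V x, act (U * V) x = act U (act V x))
    (h_cont : Continuous fun p : Matrix.unitaryGroup (Fin N) ℂ × X => act p.1 p.2)
    (F : X → Set (Matrix (Fin N) (Fin N) ℂ))
    (h_ne : ∀ x, (F x).Nonempty)
    (h_closed : ∀ x, IsClosed (F x))
    (h_convex : ∀ x, Convex ℝ (F x))
    (h_lsc : ∀ V : Set (Matrix (Fin N) (Fin N) ℂ), IsOpen V →
      IsOpen {x | (F x ∩ V).Nonempty})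
    (h_equiv : ∀ (U : Matrix.unitaryGroup (Fin N) ℂ) (x : X),
      F (act U x) =
        (fun A => (U : Matrix (Fin N) (Fin N) ℂ) * A * (U : Matrix (Fin N) (Fin N) ℂ)⁻¹) ''
          F x) :
    ∃ f : X → Matrix (Fin N) (Fin N) ℂ, Continuous f ∧ (∀ x, f x ∈ F x) ∧
      ∀ (U : Matrix.unitaryGroup (Fin N) ℂ) (x : X),
        f (act U x) = (U : Matrix (Fin N) (Fin N) ℂ) * f x * (U : Matrix (Fin N) (Fin N) ℂ)⁻¹ := by
  have hinv : ∀ U : Matrix.unitaryGroup (Fin N) ℂ,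
      (U : Matrix (Fin N) (Fin N) ℂ)⁻¹ = ((U⁻¹ : Matrix.unitaryGroup (Fin N) ℂ) :
        Matrix (Fin N) (Fin N) ℂ) := by
    intro U
    refine Matrix.inv_eq_left_inv ?_
    rw [← Matrix.UnitaryGroup.mul_val, inv_mul_cancel]
    rfl
  simp only [hinv] at h_equiv ⊢
  have := compactSpace_unitaryGroup N
  refine equivariant_michael act h_one h_mul h_cont (fun U => (LinearMap.mulRight ℝ
        ((U⁻¹ : Matrix.unitaryGroup (Fin N) ℂ) : Matrix (Fin N) (Fin N) ℂ)).comp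
      (LinearMap.mulLeft ℝ (U : Matrix (Fin N) (Fin N) ℂ))) ?_ ?_ F h_ne h_closed h_convex h_lsc
      h_equiv
  · intro U V e
    simp only [LinearMap.comp_apply, LinearMap.mulLeft_apply, LinearMap.mulRight_apply]
    rw [mul_inv_rev, Matrix.UnitaryGroup.mul_val, Matrix.UnitaryGroup.mul_val]
    simp only [mul_assoc]
  · have h2 : Continuous fun p : Matrix.unitaryGroup (Fin N) ℂ × Matrix (Fin N) (Fin N) ℂ =>
      (p.1 : Matrix (Fin N) (Fin N) ℂ) := continuous_subtype_val.comp continuous_fst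
    have h3 : Continuous fun p : Matrix.unitaryGroup (Fin N) ℂ × Matrix (Fin N) (Fin N) ℂ =>
      ((p.1⁻¹ : Matrix.unitaryGroup (Fin N) ℂ) : Matrix (Fin N) (Fin N) ℂ) :=
      continuous_subtype_val.comp continuous_fst.inv
    exact (h2.mul continuous_snd).mul h3
end
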